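/- arXiv:1103.3199 — 2 statements merged into one kernel-verified Lean document; each statement's English description precedes it below -/
import Mathlib

section
/- (Sternberg Linearisation Theorem.) Let φ be a C^∞ diffeomorphism from an open neighbourhood U of the origin in ℝⁿ onto an open subset of ℝⁿ with φ(0) = 0. Let s₁, …, sₙ ∈ ℂ denote the eigenvalues, counted with multiplicity, of the Jacobian D₀φ (i.e., the roots in ℂ of the characteristic polynomial of the matrix of D₀φ). Assume that for every index i and all non-negative integers m₁, …, mₙ with m₁ + ⋯ + mₙ > 1 one has sᵢ ≠ s₁^{m₁} ⋯ sₙ^{mₙ}. Then there exist an open neighbourhood V of 0, a C^∞ diffeomorphism ψ from V onto an open neighbourhood of 0 with ψ(0) = 0, and an open neighbourhood W ⊆ U ∩ V of 0 such that ψ(φ(x)) = (D₀φ)(ψ(x)) for all x ∈ W; that is, ψ φ ψ⁻¹ coincides with the linear map D₀φ near the origin. -/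
open scoped ContDiff

/-- `φ` is a `C^∞` diffeomorphism from the open set `U ⊆ ℝⁿ` onto an open subset of `ℝⁿ`:
`U` is open, `φ` is `C^∞` on `U`, injective on `U`, the image `φ '' U` is open, and there is a
`C^∞` inverse on the image. -/
def IsSmoothDiffeoOn (n : ℕ) (φ : EuclideanSpace ℝ (Fin n) → EuclideanSpace ℝ (Fin n))
    (U : Set (EuclideanSpace ℝ (Fin n))) : Prop :=
  IsOpen U ∧ ContDiffOn ℝ ∞ φ U ∧ Set.InjOn φ U ∧ IsOpen (φ '' U) ∧
    ∃ χ : EuclideanSpace ℝ (Fin n) → EuclideanSpace ℝ (Fin n),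
      ContDiffOn ℝ ∞ χ (φ '' U) ∧ ∀ x ∈ U, χ (φ x) = x

section Intertwining

open scoped TensorProduct

/-- A multilinear map intertwining `A` in every argument (up to the scalar `c`) with `B` vanishes
if no product of `c` with eigenvalues of `A` is an eigenvalue of `B`. -/
theorem MultilinearMap.eq_zero_of_intertwining {E F : Type*} [AddCommGroup E] [Module ℝ E]
    [FiniteDimensional ℝ E] [AddCommGroup F] [Module ℂ F] [Module ℝ F] [IsScalarTower ℝ ℂ F]
    (A : E →ₗ[ℝ] E) (B : F →ₗ[ℂ] F) :
    ∀ (m : ℕ) (c : ℂ) (M : MultilinearMap ℝ (fun _ : Fin m => E) F),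
      (∀ v, c • M (fun i => A (v i)) = B (M v)) →
      (∀ μ : Fin m → ℂ, (∀ i, Module.End.HasEigenvalue (A.baseChange ℂ) (μ i)) →
        ¬ Module.End.HasEigenvalue B (c * ∏ i, μ i)) → M = 0
  | 0, c, M, hM, hμ => by
    ext v
    by_contra hv
    refine hμ ![] (fun i => i.elim0) ?_
    refine Module.End.hasEigenvalue_of_hasEigenvector (x := M v) ?_
    refine Module.End.hasEigenvector_iff.2 ⟨Module.End.mem_eigenspace_iff.2 ?_, by simpa using hv⟩
    rw [← hM v]
    simp only [Finset.univ_eq_empty, Finset.prod_empty, mul_one]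
    congr 2
    exact Subsingleton.elim _ _
  | m + 1, c, M, hM, hμ => by
    have : IsScalarTower ℝ ℂ (MultilinearMap ℝ (fun _ : Fin m => E) F) :=
      ⟨fun a b N => by ext v; exact smul_assoc a b (N v)⟩
    set L : ℂ ⊗[ℝ] E →ₗ[ℂ] MultilinearMap ℝ (fun _ : Fin m => E) F :=
      LinearMap.liftBaseChange ℂ M.curryLeft with hL
    have key : ∀ z v, c • L (A.baseChange ℂ z) (fun i => A (v i)) = B (L z v) := by
      intro z v
      induction z with
      | zero => simp
      | tmul a x =>
        simp only [LinearMap.baseChange_tmul, hL, LinearMap.liftBaseChange_tmul,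
          smul_apply, MultilinearMap.curryLeft_apply, map_smul]
        rw [← hM, smul_comm]
        congr 3
        ext i
        refine Fin.cases ?_ (fun j => ?_) i <;> simp
      | add x y hx hy => simp only [map_add, add_apply, smul_add, hx, hy]
    have hgen : ∀ μ : ℂ, ∀ r : ℕ, ∀ z,
        ((A.baseChange ℂ - algebraMap ℂ (Module.End ℂ (ℂ ⊗[ℝ] E)) μ) ^ r) z = 0 → L z = 0 := by
      intro μ r
      induction r with
      | zero => intro z hz; simp at hz; simp [hz]
      | succ r ih =>
        intro z hz
        by_cases hev : Module.End.HasEigenvalue (A.baseChange ℂ) μ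
        · have h1 := ih _ (by rwa [pow_succ, Module.End.mul_apply] at hz)
          simp only [LinearMap.sub_apply, map_sub, Module.algebraMap_end_apply, map_smul,
            sub_eq_zero] at h1
          refine eq_zero_of_intertwining A B m (c * μ) (L z) (fun v => ?_) fun μ' hμ' => ?_
          · rw [← key z v, h1, smul_apply, smul_smul]
          · have := hμ (Fin.cons μ μ') (fun i => ?_)
            · rwa [Fin.prod_univ_succ, Fin.cons_zero, ← mul_assoc] at this
            · refine Fin.cases ?_ (fun j => ?_) i
              · simpa using hev
              · simpa using hμ' j
        · have hinj : z = 0 := by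
            by_contra hz0
            refine hev (Module.End.hasEigenvalue_of_hasGenEigenvalue (k := r + 1) ?_)
            intro hbot
            apply hz0
            have : z ∈ Module.End.genEigenspace (A.baseChange ℂ) μ ((r + 1 : ℕ) : ℕ∞) := by
              rw [Module.End.mem_genEigenspace_nat]
              exact hz
            rw [hbot] at this
            simpa using this
          simp [hinj]
    have hker : (⊤ : Submodule ℂ (ℂ ⊗[ℝ] E)) ≤ LinearMap.ker L := by
      rw [← Module.End.iSup_maxGenEigenspace_eq_top (A.baseChange ℂ)]
      refine iSup_le fun μ z hz => ?_
      obtain ⟨r, hr⟩ := (Module.End.mem_maxGenEigenspace _ _ _).1 hz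
      exact hgen μ r z hr
    ext v
    have h0 : L (1 ⊗ₜ[ℝ] v 0) = 0 := hker trivial
    have h1 := congrArg (fun N => N (Fin.tail v)) h0
    simpa [hL] using h1

/-- A multilinear map on finite-dimensional spaces is continuous. -/
theorem MultilinearMap.continuous_of_finiteDimensional {E F : Type*} [NormedAddCommGroup E]
    [NormedSpace ℝ E] [FiniteDimensional ℝ E] [NormedAddCommGroup F] [NormedSpace ℝ F] {m : ℕ}
    (M : MultilinearMap ℝ (fun _ : Fin m => E) F) : Continuous M := by
  classical
  let b := Module.finBasis ℝ E
  have h : ∀ v, M v = ∑ r : Fin m → Fin (Module.finrank ℝ E),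
      (∏ i, b.equivFunL (v i) (r i)) • M (fun i => b (r i)) := by
    intro v
    conv_lhs => rw [show v = fun i => ∑ j, b.equivFunL (v i) j • b j from
      funext fun i => (b.sum_equivFun (v i)).symm]
    rw [MultilinearMap.map_sum]
    exact Finset.sum_congr rfl fun r _ => M.map_smul_univ _ _
  rw [show (M : (Fin m → E) → F) = _ from funext h]
  fun_prop

/-- Solvability of the multilinear Sylvester equation. -/
theorem exists_sylvester_solution {E F : Type*} [NormedAddCommGroup E] [NormedSpace ℝ E]
    [FiniteDimensional ℝ E] [NormedAddCommGroup F] [NormedSpace ℝ F] [FiniteDimensional ℝ F]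
    (A : E →L[ℝ] E) (B : F →L[ℝ] F) (m : ℕ)
    (h : ∀ μ : Fin m → ℂ, (∀ i, Module.End.HasEigenvalue ((A : E →ₗ[ℝ] E).baseChange ℂ) (μ i)) →
        ¬ Module.End.HasEigenvalue ((B : F →ₗ[ℝ] F).baseChange ℂ) (∏ i, μ i))
    (Q : ContinuousMultilinearMap ℝ (fun _ : Fin m => E) F) :
    ∃ M : ContinuousMultilinearMap ℝ (fun _ : Fin m => E) F,
      ∀ v, M (fun i => A (v i)) - B (M v) = Q v := by
  let T : MultilinearMap ℝ (fun _ : Fin m => E) F →ₗ[ℝ] MultilinearMap ℝ (fun _ : Fin m => E) F :=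
    { toFun := fun M => M.compLinearMap (fun _ => (A : E →ₗ[ℝ] E))
        - (B : F →ₗ[ℝ] F).compMultilinearMap M
      map_add' := fun M N => by ext v; simp; abel
      map_smul' := fun c M => by ext v; simp [smul_sub] }
  have hT : Function.Injective T := by
    rw [← LinearMap.ker_eq_bot, LinearMap.ker_eq_bot']
    intro M hM
    let ι : F →ₗ[ℝ] ℂ ⊗[ℝ] F := TensorProduct.mk ℝ ℂ F 1
    have hι : Function.Injective ι := by
      intro x y hxy
      exact Module.FaithfullyFlat.tensorProduct_mk_injective (A := ℝ) (B := ℂ) F hxy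
    have := MultilinearMap.eq_zero_of_intertwining (A : E →ₗ[ℝ] E)
      ((B : F →ₗ[ℝ] F).baseChange ℂ) m 1 (ι.compMultilinearMap M) (fun v => ?_)
      (by simpa using h)
    · ext v
      apply hι
      simpa using congrArg (fun N => N v) this
    · have h2 := congrArg (fun N => N v) hM
      simp only [T, LinearMap.coe_mk, AddHom.coe_mk, sub_apply, sub_eq_zero,
        MultilinearMap.compLinearMap_apply, LinearMap.compMultilinearMap_apply,
        zero_apply] at h2
      simpa [ι] using congrArg (fun y => (1 : ℂ) ⊗ₜ[ℝ] y) h2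
  obtain ⟨M, hM⟩ := (LinearMap.injective_iff_surjective.1 hT) Q.toMultilinearMap
  refine ⟨⟨M, ?_⟩, fun v => ?_⟩
  · exact M.continuous_of_finiteDimensional
  · have h3 := congrArg (fun N => N v) hM
    simp only [T, LinearMap.coe_mk, AddHom.coe_mk, sub_apply,
      MultilinearMap.compLinearMap_apply, LinearMap.compMultilinearMap_apply] at h3
    exact h3

end Intertwining

section FlatFunctions

open Filter Asymptotics Topology

variable {E F : Type*} [NormedAddCommGroup E] [NormedAddCommGroup F]

/-- `f` vanishes to infinite order at the origin. -/
def IsFlatAtZero (f : E → F) : Prop := ∀ N : ℕ, f =O[𝓝 0] fun x => ‖x‖ ^ N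

theorem IsFlatAtZero.map_zero {f : E → F} (hf : IsFlatAtZero f) : f 0 = 0 := by
  obtain ⟨C, hC⟩ := (hf 1).bound
  simpa using hC.self_of_nhds

theorem isBigO_norm_pow_of_le {f : E → F} {N K : ℕ} (hNK : N ≤ K)
    (h : f =O[𝓝 0] fun x => ‖x‖ ^ K) : f =O[𝓝 0] fun x => ‖x‖ ^ N := by
  refine h.trans (IsBigO.of_bound 1 ?_)
  filter_upwards [Metric.closedBall_mem_nhds (0 : E) one_pos] with x hx
  rw [mem_closedBall_zero_iff] at hx
  simpa using pow_le_pow_of_le_one (norm_nonneg x) hx hNK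

variable [NormedSpace ℝ E] [NormedSpace ℝ F]

theorem IsFlatAtZero.hasFDerivAt {f : E → F} (hf : IsFlatAtZero f) :
    HasFDerivAt f (0 : E →L[ℝ] F) 0 := by
  refine IsBigO.hasFDerivAt (n := 2) ?_ (by norm_num)
  simpa using hf 2

/-- By interpolation with the second derivative, the derivative of a smooth flat function is
flat. -/
theorem IsFlatAtZero.fderiv {f : E → F} (hf : IsFlatAtZero f) (hs : ContDiff ℝ 2 f) :
    IsFlatAtZero (fderiv ℝ f) := by
  intro N
  refine isBigO_norm_pow_of_le N.le_succ ?_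
  obtain ⟨C, hCpos, hC⟩ := (hf (2 * (N + 1))).exists_pos
  have hdf : ContDiff ℝ 1 (_root_.fderiv ℝ f) := hs.fderiv_right (by norm_num)
  obtain ⟨K, s, hsn, hK⟩ := (hdf.contDiffAt (x := 0)).exists_lipschitzOnWith
  obtain ⟨r, hr, hrs⟩ := Metric.mem_nhds_iff.1 (inter_mem hsn hC.bound)
  refine IsBigO.of_bound (K + C * 2 ^ (2 * (N + 1)) + C) ?_
  filter_upwards [Metric.closedBall_mem_nhds (0 : E) one_pos,
    Metric.ball_mem_nhds (0 : E) (half_pos hr)] with x hx1 hx2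
  rw [mem_closedBall_zero_iff] at hx1
  rw [mem_ball_zero_iff] at hx2
  rcases eq_or_ne x 0 with rfl | hx0
  · simp [hf.hasFDerivAt.fderiv]
  have hxpos : 0 < ‖x‖ := norm_pos_iff.2 hx0
  set t := ‖x‖ ^ (N + 1) with ht
  have htpos : 0 < t := by positivity
  have htx : t ≤ ‖x‖ := by
    simpa using pow_le_pow_of_le_one hxpos.le hx1 (Nat.succ_le_succ N.zero_le)
  have hball : ∀ z ∈ Metric.closedBall x t, z ∈ Metric.ball (0 : E) r ∧ ‖z‖ ≤ 2 * ‖x‖ := by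
    intro z hz
    rw [mem_closedBall_iff_norm] at hz
    have : ‖z‖ ≤ 2 * ‖x‖ := by
      calc ‖z‖ = ‖(z - x) + x‖ := by simp
        _ ≤ ‖z - x‖ + ‖x‖ := norm_add_le _ _
        _ ≤ 2 * ‖x‖ := by linarith
    refine ⟨?_, this⟩
    rw [mem_ball_zero_iff]
    linarith
  have hxx : x ∈ Metric.closedBall x t := Metric.mem_closedBall_self htpos.le
  have hfx : ∀ z ∈ Metric.closedBall x t, ‖f z‖ ≤ C * ‖z‖ ^ (2 * (N + 1)) := by
    intro z hz
    have := (hrs (hball z hz).1).2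
    simpa using this
  have hmv : ∀ z ∈ Metric.closedBall x t,
      ‖f z - f x - _root_.fderiv ℝ f x (z - x)‖ ≤ K * t * ‖z - x‖ := by
    intro z hz
    refine Convex.norm_image_sub_le_of_norm_fderiv_le' (s := Metric.closedBall x t) (𝕜 := ℝ)
      (fun y _ => (hs.differentiable (by norm_num)).differentiableAt) (fun y hy => ?_)
      (convex_closedBall x t) hxx hz
    have h1 := hK.dist_le_mul y (hrs (hball y hy).1).1 x (hrs (hball x hxx).1).1
    rw [dist_eq_norm] at h1
    refine h1.trans ?_
    have : dist y x ≤ t := hy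
    gcongr
  rw [norm_pow, norm_norm, ← ht]
  refine ContinuousLinearMap.opNorm_le_bound _ (by positivity) fun v => ?_
  rcases eq_or_ne v 0 with rfl | hv0
  · simp
  have hvpos : 0 < ‖v‖ := norm_pos_iff.2 hv0
  set h : E := (t / ‖v‖) • v with hh
  have hnh : ‖h‖ = t := by
    rw [hh, norm_smul, Real.norm_of_nonneg (by positivity)]
    field_simp
  have hz : x + h ∈ Metric.closedBall x t := by
    rw [mem_closedBall_iff_norm]; simp [hnh]
  have h1 := hmv _ hz
  rw [add_sub_cancel_left, hnh] at h1
  have h2 := hfx _ hz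
  have h3 := hfx _ hxx
  have h4 : ‖x + h‖ ^ (2 * (N + 1)) ≤ 2 ^ (2 * (N + 1)) * t ^ 2 := by
    calc ‖x + h‖ ^ (2 * (N + 1)) ≤ (2 * ‖x‖) ^ (2 * (N + 1)) := by
          gcongr; exact (hball _ hz).2
      _ = _ := by rw [mul_pow, ht, ← pow_mul, mul_comm (N + 1) 2]
  have h5 : ‖x‖ ^ (2 * (N + 1)) = t ^ 2 := by rw [ht, ← pow_mul, mul_comm (N + 1) 2]
  rw [h5] at h3
  have h6 : ‖_root_.fderiv ℝ f x h‖ ≤ (K + C * 2 ^ (2 * (N + 1)) + C) * t * t := by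
    have : _root_.fderiv ℝ f x h = f (x + h) - f x - (f (x + h) - f x - _root_.fderiv ℝ f x h) := by
      abel
    rw [this]
    refine (norm_sub_le _ _).trans ?_
    have h7 := norm_sub_le (f (x + h)) (f x)
    have h8 : C * ‖x + h‖ ^ (2 * (N + 1)) ≤ C * (2 ^ (2 * (N + 1)) * t ^ 2) := by gcongr
    nlinarith
  rw [hh, map_smul, norm_smul, Real.norm_of_nonneg (by positivity)] at h6
  have h9 : t / ‖v‖ * ‖_root_.fderiv ℝ f x v‖ ≤
      t / ‖v‖ * ((K + C * 2 ^ (2 * (N + 1)) + C) * t * ‖v‖) := by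
    refine h6.trans (le_of_eq ?_)
    field_simp
  exact le_of_mul_le_mul_left h9 (by positivity)

theorem IsFlatAtZero.iteratedFDeriv {f : E → F} (hf : IsFlatAtZero f) (hs : ContDiff ℝ ∞ f) (i : ℕ) :
    IsFlatAtZero (iteratedFDeriv ℝ i f) := by
  induction i with
  | zero =>
    intro N
    refine IsBigO.of_norm_left ?_
    simpa using (hf N).norm_left
  | succ i ih =>
    have h2 : ContDiff ℝ 2 (_root_.iteratedFDeriv ℝ i f) :=
      hs.iteratedFDeriv_right (WithTop.coe_le_coe.2 (le_top (a := ((2 + i : ℕ) : ℕ∞))))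
    intro N
    refine IsBigO.of_norm_left ?_
    simpa [norm_fderiv_iteratedFDeriv] using (ih.fderiv h2 N).norm_left

/-- A continuous flat function obeys its flatness bounds on every closed ball. -/
theorem IsFlatAtZero.exists_bound {E F : Type*} [NormedAddCommGroup E] [NormedSpace ℝ E]
    [FiniteDimensional ℝ E] [NormedAddCommGroup F] {f : E → F} (hf : IsFlatAtZero f)
    (hc : Continuous f) (R : ℝ) (N : ℕ) : ∃ C, 0 ≤ C ∧ ∀ x, ‖x‖ ≤ R → ‖f x‖ ≤ C * ‖x‖ ^ N := by
  obtain ⟨C, hCpos, hC⟩ := (hf N).exists_pos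
  obtain ⟨r, hr, hrC⟩ := Metric.mem_nhds_iff.1 hC.bound
  obtain ⟨D, hD⟩ := (isCompact_closedBall (0 : E) R).exists_bound_of_continuousOn hc.continuousOn
  refine ⟨C + |D| / r ^ N, by positivity, fun x hx => ?_⟩
  by_cases hxr : ‖x‖ < r
  · have h1 : ‖f x‖ ≤ C * ‖x‖ ^ N := by simpa using hrC (mem_ball_zero_iff.2 hxr)
    refine h1.trans ?_
    gcongr
    exact le_add_of_nonneg_right (by positivity)
  · push Not at hxr
    calc ‖f x‖ ≤ |D| := (hD x (mem_closedBall_zero_iff.2 hx)).trans (le_abs_self D)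
      _ = |D| / r ^ N * r ^ N := by field_simp
      _ ≤ |D| / r ^ N * ‖x‖ ^ N := by gcongr
      _ ≤ _ := by gcongr; exact le_add_of_nonneg_left hCpos.le

/-- A function that is smooth away from the origin, with all derivatives decaying faster than any
power, is smooth. -/
theorem contDiff_of_isBigO_punctured {f : E → F} (h0 : f 0 = 0)
    (hs : ∀ x, x ≠ 0 → ContDiffAt ℝ ∞ f x)
    (hf : ∀ i N : ℕ, iteratedFDeriv ℝ i f =O[𝓝[≠] 0] fun x => ‖x‖ ^ N) : ContDiff ℝ ∞ f := by
  have hz : ∀ i : ℕ, iteratedFDeriv ℝ i f 0 = 0 →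
      HasFDerivAt (iteratedFDeriv ℝ i f) (0 : E →L[ℝ] _) 0 := by
    intro i hi
    refine IsBigO.hasFDerivAt (n := 2) ?_ (by norm_num)
    rw [← nhdsNE_sup_pure, isBigO_sup]
    refine ⟨by simpa using hf i 2, ?_⟩
    rw [isBigO_pure]
    simp [hi]
  have hzero : ∀ i : ℕ, iteratedFDeriv ℝ i f 0 = 0 := by
    intro i
    induction i with
    | zero => ext; simp [h0]
    | succ i ih =>
      have h1 : ‖fderiv ℝ (iteratedFDeriv ℝ i f) 0‖ = 0 := by
        rw [(hz i ih).fderiv]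
        exact norm_zero (E := E →L[ℝ] (E [×i]→L[ℝ] F))
      rwa [norm_fderiv_iteratedFDeriv, norm_eq_zero] at h1
  refine contDiff_of_differentiable_iteratedFDeriv fun i _ x => ?_
  rcases eq_or_ne x 0 with rfl | hx
  · exact (hz i (hzero i)).differentiableAt
  · exact (hs x hx).differentiableAt_iteratedFDeriv (by exact_mod_cast ENat.natCast_lt_top i)

/-- Derivatives of a function homogeneous of degree zero. -/
theorem exists_norm_iteratedFDeriv_le_of_homogeneous [FiniteDimensional ℝ E] {f : E → F}
    (hs : ∀ x, x ≠ 0 → ContDiffAt ℝ ∞ f x) (hh : ∀ t : ℝ, 0 < t → ∀ x, f (t • x) = f x) (i : ℕ) :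
    ∃ C, 0 ≤ C ∧ ∀ x, x ≠ 0 → ‖iteratedFDeriv ℝ i f x‖ ≤ C * (‖x‖⁻¹) ^ i := by
  have hc : ContinuousOn (iteratedFDeriv ℝ i f) (Metric.sphere 0 1) := by
    intro x hx
    have hx0 : x ≠ 0 := by
      rintro rfl
      simp at hx
    exact ((hs x hx0).iteratedFDeriv_right (m := 0)
      (by exact_mod_cast le_top)).continuousAt.continuousWithinAt
  obtain ⟨C, hC⟩ := (isCompact_sphere (0 : E) 1).exists_bound_of_continuousOn hc
  refine ⟨|C|, abs_nonneg C, fun x hx => ?_⟩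
  have hxpos : 0 < ‖x‖ := norm_pos_iff.2 hx
  let e : E ≃L[ℝ] E := ContinuousLinearEquiv.smulLeft (Units.mk0 ‖x‖⁻¹ (by positivity))
  have he : ∀ y, e y = ‖x‖⁻¹ • y := fun y => rfl
  have hfe : f ∘ e = f := by
    ext y
    simp only [Function.comp_apply, he]
    exact hh _ (by positivity) y
  have h1 := e.iteratedFDerivWithin_comp_right f (s := Set.univ) uniqueDiffOn_univ
    (Set.mem_univ (e x)) i
  rw [Set.preimage_univ, iteratedFDerivWithin_univ, iteratedFDerivWithin_univ, hfe] at h1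
  rw [h1]
  refine (ContinuousMultilinearMap.norm_compContinuousLinearMap_le _ _).trans ?_
  have h2 : ‖(e : E →L[ℝ] E)‖ ≤ ‖x‖⁻¹ := by
    refine ContinuousLinearMap.opNorm_le_bound _ (by positivity) fun y => ?_
    rw [ContinuousLinearEquiv.coe_coe, he, norm_smul, norm_inv, norm_norm]
  have h3 : ‖iteratedFDeriv ℝ i f (e x)‖ ≤ |C| := by
    refine (hC _ ?_).trans (le_abs_self C)
    rw [mem_sphere_zero_iff_norm, he, norm_smul, norm_inv, norm_norm]
    field_simp
  simp only [Finset.prod_const, Finset.card_univ, Fintype.card_fin]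
  gcongr

/-- The product of a flat smooth function with a function that is smooth and homogeneous of degree
zero away from the origin is smooth. -/
theorem IsFlatAtZero.contDiff_homogeneous_smul [FiniteDimensional ℝ E] {g : E → F} {u : E → ℝ}
    (hg : IsFlatAtZero g) (hgs : ContDiff ℝ ∞ g) (hus : ∀ x, x ≠ 0 → ContDiffAt ℝ ∞ u x)
    (hu : ∀ t : ℝ, 0 < t → ∀ x, u (t • x) = u x) : ContDiff ℝ ∞ fun x => u x • g x := by
  refine contDiff_of_isBigO_punctured (by simp [hg.map_zero])
    (fun x hx => (hus x hx).smul hgs.contDiffAt) fun i N => ?_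
  choose C hC0 hC using exists_norm_iteratedFDeriv_le_of_homogeneous hus hu
  have hopen : IsOpen ({0}ᶜ : Set E) := isOpen_compl_singleton
  have hb : (_root_.iteratedFDeriv ℝ i fun x => u x • g x) =O[𝓝[≠] 0] fun x =>
      ∑ j ∈ Finset.range (i + 1),
        ((i.choose j : ℝ) * C j * (‖x‖⁻¹) ^ j * ‖_root_.iteratedFDeriv ℝ (i - j) g x‖) := by
    refine IsBigO.of_bound 1 ?_
    filter_upwards [self_mem_nhdsWithin] with x hx
    have h1 := norm_iteratedFDerivWithin_smul_le (𝕜 := ℝ) (s := ({0}ᶜ : Set E)) (f := u) (g := g)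
      (N := ∞) (fun y hy => (hus y hy).contDiffWithinAt) hgs.contDiffOn hopen.uniqueDiffOn hx
      (n := i) (by exact_mod_cast le_top)
    rw [iteratedFDerivWithin_of_isOpen i hopen hx] at h1
    rw [one_mul]
    refine (h1.trans (Finset.sum_le_sum fun j _ => ?_)).trans (le_abs_self _)
    rw [iteratedFDerivWithin_of_isOpen _ hopen hx, iteratedFDerivWithin_of_isOpen _ hopen hx]
    have := hC0 j
    rw [mul_assoc _ (C j)]
    gcongr
    exact hC j x hx
  refine hb.trans (IsBigO.fun_sum fun j _ => ?_)
  have h2 := (((hg.iteratedFDeriv hgs (i - j)) (N + j)).mono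
    (nhdsWithin_le_nhds (s := {0}ᶜ))).norm_left
  refine (((isBigO_refl (fun x : E => (‖x‖⁻¹) ^ j) _).const_mul_left
    ((i.choose j : ℝ) * C j)).mul h2).trans (IsBigO.of_bound 1 ?_)
  filter_upwards [self_mem_nhdsWithin] with x hx
  have hxpos : 0 < ‖x‖ := norm_pos_iff.2 hx
  rw [one_mul, pow_add, inv_pow]
  refine le_of_eq (congrArg _ ?_)
  field_simp

end FlatFunctions

section CohomologicalEquation

open Filter Asymptotics Topology

variable {E F : Type*} [NormedAddCommGroup E] [NormedSpace ℝ E]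
  [NormedAddCommGroup F] [NormedSpace ℝ F]

/-- Composition with a map whose derivatives are globally bounded. -/
theorem exists_norm_iteratedFDeriv_comp_le {f : E → E} (hf : ContDiff ℝ ∞ f)
    (hfb : ∀ i, 1 ≤ i → ∃ C, ∀ x, ‖iteratedFDeriv ℝ i f x‖ ≤ C) (B : F →L[ℝ] F) (j : ℕ) :
    ∃ K, 0 ≤ K ∧ ∀ (h : E → F) (x : E) (S : ℝ), ContDiff ℝ ∞ h →
      (∀ i ≤ j, ‖iteratedFDeriv ℝ i h (f x)‖ ≤ S) →
      ∀ i ≤ j, ‖iteratedFDeriv ℝ i (fun y => B (h (f y))) x‖ ≤ K * S := by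
  choose! C hC using hfb
  set D := 1 + ∑ i ∈ Finset.range (j + 1), |C i| with hD
  have hD1 : 1 ≤ D := le_add_of_nonneg_right (by positivity)
  refine ⟨‖B‖ * (j.factorial * D ^ j), by positivity, fun h x S hh hS i hi => ?_⟩
  have hS0 : 0 ≤ S := (norm_nonneg _).trans (hS 0 j.zero_le)
  have h1 : ‖iteratedFDeriv ℝ i (h ∘ f) x‖ ≤ i.factorial * S * D ^ i := by
    refine norm_iteratedFDeriv_comp_le (N := ∞) hh hf (by exact_mod_cast le_top) x
      (fun l hl => hS l (hl.trans hi)) fun l hl1 hl => ?_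
    calc ‖iteratedFDeriv ℝ l f x‖ ≤ |C l| := (hC l hl1 x).trans (le_abs_self _)
      _ ≤ ∑ i ∈ Finset.range (j + 1), |C i| :=
        Finset.single_le_sum (f := fun i => |C i|) (fun _ _ => abs_nonneg _)
          (Finset.mem_range.2 (by omega))
      _ ≤ D := by linarith
      _ ≤ D ^ l := le_self_pow₀ hD1 (by omega)
  have h2 := B.norm_iteratedFDeriv_comp_left (f := h ∘ f) (x := x) (N := ∞) (n := i)
    (hh.comp hf).contDiffAt (by exact_mod_cast le_top)
  calc _ ≤ ‖B‖ * ‖iteratedFDeriv ℝ i (h ∘ f) x‖ := h2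
    _ ≤ ‖B‖ * (i.factorial * S * D ^ i) := by gcongr
    _ ≤ ‖B‖ * (j.factorial * S * D ^ j) := by gcongr
    _ = _ := by ring

/-- Radial cutoff of the identity. -/
theorem exists_smooth_retraction (E : Type*) [NormedAddCommGroup E] [NormedSpace ℝ E]
    [FiniteDimensional ℝ E] : ∃ ρ : E → E, ContDiff ℝ ∞ ρ ∧ (∀ x, ‖ρ x‖ ≤ 1) ∧
      (∀ᶠ x in 𝓝 0, ρ x = x) ∧ ∀ i, ∃ C, ∀ x, ‖iteratedFDeriv ℝ i ρ x‖ ≤ C := by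
  let b : ContDiffBump (0 : E) := ⟨1 / 2, 1, by norm_num, by norm_num⟩
  have hs : ContDiff ℝ ∞ fun x : E => b x • x := b.contDiff.smul contDiff_id
  have hsupp : HasCompactSupport fun x : E => b x • x := b.hasCompactSupport.smul_right
  refine ⟨fun x => b x • x, hs, fun x => ?_, ?_, fun i => ?_⟩
  · by_cases hx : ‖x‖ ≤ 1
    · rw [norm_smul, Real.norm_of_nonneg b.nonneg]
      exact mul_le_one₀ b.le_one (norm_nonneg _) hx
    · have : b x = 0 := b.zero_of_le_dist (by simpa using (not_le.1 hx).le)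
      simp [this]
  · filter_upwards [b.eventuallyEq_one] with x hx
    simp [hx]
  · exact (hs.continuous_iteratedFDeriv (by exact_mod_cast le_top)).bounded_above_of_compact_support
      (hsupp.iteratedFDeriv i)

/-- The iterates `gₖ = Bᵏ ∘ g ∘ Φᵏ` of a smooth flat function `g` decay geometrically, together
with their derivatives, if the part of the orbits of `Φ` lying in the support of `g` contracts
exponentially. -/
theorem IsFlatAtZero.exists_norm_iteratedFDeriv_iterate_le [FiniteDimensional ℝ E] {Φ : E → E}
    (hΦ : ContDiff ℝ ∞ Φ) (hΦb : ∀ i, 1 ≤ i → ∃ C, ∀ x, ‖_root_.iteratedFDeriv ℝ i Φ x‖ ≤ C)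
    (B : F →L[ℝ] F) {g : E → F} (hg : IsFlatAtZero g) (hgs : ContDiff ℝ ∞ g) {c μ : ℝ} (hc : 0 ≤ c)
    (hμ0 : 0 ≤ μ) (hμ1 : μ < 1)
    (hcontr : ∀ k i x, _root_.iteratedFDeriv ℝ i g (Φ^[k] x) ≠ 0 → ‖Φ^[k] x‖ ≤ c * μ ^ k * ‖x‖)
    (j N : ℕ) : ∃ C, 0 ≤ C ∧ ∀ k, ∀ i ≤ j, ∀ x, ‖x‖ ≤ 1 →
      ‖_root_.iteratedFDeriv ℝ i ((fun (h : E → F) y => B (h (Φ y)))^[k] g) x‖ ≤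
        C * (1 / 2) ^ k * ‖x‖ ^ N := by
  set T : (E → F) → E → F := fun h y => B (h (Φ y)) with hT
  obtain ⟨K, hK0, hK⟩ := exists_norm_iteratedFDeriv_comp_le hΦ hΦb B j
  have hTs : ∀ k, ContDiff ℝ ∞ (T^[k] g) := by
    intro k
    induction k with
    | zero => exact hgs
    | succ k ih =>
      rw [Function.iterate_succ_apply']
      exact B.contDiff.comp (ih.comp hΦ)
  have hiter : ∀ (S : ℝ) k x, (∀ i ≤ j, ‖_root_.iteratedFDeriv ℝ i g (Φ^[k] x)‖ ≤ S) →
      ∀ i ≤ j, ‖_root_.iteratedFDeriv ℝ i (T^[k] g) x‖ ≤ K ^ k * S := by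
    intro S k
    induction k with
    | zero => intro x hx; simpa using hx
    | succ k ih =>
      intro x hx
      rw [Function.iterate_succ_apply', pow_succ', mul_assoc]
      exact hK _ x _ (hTs k) (ih (Φ x) hx)
  obtain ⟨M₀, hM₀⟩ : ∃ M₀ : ℕ, K * μ ^ M₀ ≤ 1 / 2 := by
    have : Tendsto (fun M : ℕ => K * μ ^ M) atTop (𝓝 (K * 0)) :=
      (tendsto_pow_atTop_nhds_zero_of_lt_one hμ0 hμ1).const_mul K
    rw [mul_zero] at this
    exact (this.eventually (ge_mem_nhds (by norm_num))).exists
  set M := M₀ + N with hM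
  have hKM : K * μ ^ M ≤ 1 / 2 := by
    refine le_trans ?_ hM₀
    gcongr K * ?_
    exact pow_le_pow_of_le_one hμ0 hμ1.le (by omega)
  have hbd : ∀ i, ∃ C, 0 ≤ C ∧ ∀ x, ‖x‖ ≤ c → ‖_root_.iteratedFDeriv ℝ i g x‖ ≤ C * ‖x‖ ^ M :=
    fun i => (hg.iteratedFDeriv hgs i).exists_bound
      (hgs.continuous_iteratedFDeriv (by exact_mod_cast le_top)) c M
  choose C hC0 hC using hbd
  set D := ∑ i ∈ Finset.range (j + 1), C i with hD
  have hD0 : 0 ≤ D := Finset.sum_nonneg fun i _ => hC0 i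
  refine ⟨D * c ^ M, by positivity, fun k i hi x hx => ?_⟩
  refine (hiter (D * (c * μ ^ k * ‖x‖) ^ M) k x (fun l hl => ?_) i hi).trans ?_
  · by_cases h0 : _root_.iteratedFDeriv ℝ l g (Φ^[k] x) = 0
    · rw [h0, norm_zero]; positivity
    · have h1 := hcontr k l x h0
      have h2 : c * μ ^ k * ‖x‖ ≤ c := by
        have := pow_le_one₀ (n := k) hμ0 hμ1.le
        calc c * μ ^ k * ‖x‖ ≤ c * 1 * 1 := by gcongr
          _ = c := by ring
      refine (hC l _ (h1.trans h2)).trans ?_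
      gcongr
      exact Finset.single_le_sum (f := C) (fun _ _ => hC0 _) (Finset.mem_range.2 (by omega))
  · calc K ^ k * (D * (c * μ ^ k * ‖x‖) ^ M) = D * c ^ M * (K * μ ^ M) ^ k * ‖x‖ ^ M := by
          rw [mul_pow, mul_pow, mul_pow, ← pow_mul, ← pow_mul, mul_comm k M]; ring
      _ ≤ D * c ^ M * (1 / 2) ^ k * ‖x‖ ^ N := by
          gcongr D * c ^ M * ?_ ^ k * ?_
          exact pow_le_pow_of_le_one (norm_nonneg _) hx (by omega)

/-- Smooth flat solutions of the cohomological equation `h = g + B ∘ h ∘ Φ` near the origin. -/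
theorem IsFlatAtZero.exists_cohomological_solution [FiniteDimensional ℝ E] [CompleteSpace F]
    {Φ : E → E} (hΦ : ContDiff ℝ ∞ Φ) (hΦ0 : Φ 0 = 0)
    (hΦb : ∀ i, 1 ≤ i → ∃ C, ∀ x, ‖_root_.iteratedFDeriv ℝ i Φ x‖ ≤ C)
    (B : F →L[ℝ] F) {g : E → F} (hg : IsFlatAtZero g) (hgs : ContDiff ℝ ∞ g) {c μ : ℝ} (hc : 0 ≤ c)
    (hμ0 : 0 ≤ μ) (hμ1 : μ < 1)
    (hcontr : ∀ k i x, _root_.iteratedFDeriv ℝ i g (Φ^[k] x) ≠ 0 →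
      ‖Φ^[k] x‖ ≤ c * μ ^ k * ‖x‖) :
    ∃ h : E → F, ContDiff ℝ ∞ h ∧ IsFlatAtZero h ∧ ∀ᶠ x in 𝓝 0, h x = g x + B (h (Φ x)) := by
  set T : (E → F) → E → F := fun h y => B (h (Φ y)) with hT
  have hTs : ∀ k, ContDiff ℝ ∞ (T^[k] g) := by
    intro k
    induction k with
    | zero => exact hgs
    | succ k ih =>
      rw [Function.iterate_succ_apply']
      exact B.contDiff.comp (ih.comp hΦ)
  have hbd := hg.exists_norm_iteratedFDeriv_iterate_le hΦ hΦb B hgs hc hμ0 hμ1 hcontr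
  obtain ⟨ρ, hρ, hρ1, hρid, hρb⟩ := exists_smooth_retraction E
  have hsum : ∀ x, Summable fun k => T^[k] g (ρ x) := by
    intro x
    obtain ⟨C, hC0, hC⟩ := hbd 0 0
    refine Summable.of_norm_bounded (summable_geometric_two.mul_left C) fun k => ?_
    simpa using hC k 0 le_rfl _ (hρ1 x)
  refine ⟨fun x => ∑' k, T^[k] g (ρ x), ?_, fun N => ?_, ?_⟩
  · have hder : ∀ j : ℕ, ∃ C, ∀ k x,
        ‖_root_.iteratedFDeriv ℝ j (fun x => T^[k] g (ρ x)) x‖ ≤ C * (1 / 2) ^ k := by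
      intro j
      obtain ⟨C, hC0, hC⟩ := hbd j 0
      obtain ⟨K, hK0, hK⟩ := exists_norm_iteratedFDeriv_comp_le hρ (fun i _ => hρb i)
        (ContinuousLinearMap.id ℝ F) j
      refine ⟨K * C, fun k x => ?_⟩
      rw [mul_assoc]
      refine hK (T^[k] g) x _ (hTs k) (fun i hi => ?_) j le_rfl
      simpa using hC k i hi (ρ x) (hρ1 x)
    choose C hC using hder
    exact contDiff_tsum (v := fun j k => C j * (1 / 2) ^ k) (fun k => (hTs k).comp hρ)
      (fun j _ => summable_geometric_two.mul_left _) fun j k x _ => hC j k x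
  · obtain ⟨C, hC0, hC⟩ := hbd 0 N
    refine IsBigO.of_bound (C * 2) ?_
    filter_upwards [hρid] with x hx
    rw [norm_pow, norm_norm]
    have h1 : ∀ k, ‖T^[k] g (ρ x)‖ ≤ C * ‖x‖ ^ N * (1 / 2) ^ k := by
      intro k
      have := hC k 0 le_rfl (ρ x) (hρ1 x)
      rw [norm_iteratedFDeriv_zero, hx] at this
      rw [hx]
      linarith
    refine (tsum_of_norm_bounded (hasSum_geometric_two.mul_left _) h1).trans (le_of_eq (by ring))
  · have hρΦ : ∀ᶠ x in 𝓝 0, ρ (Φ x) = Φ x := by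
      have : Tendsto Φ (𝓝 0) (𝓝 0) := by simpa [hΦ0] using hΦ.continuous.tendsto 0
      exact this.eventually hρid
    filter_upwards [hρid, hρΦ] with x hx hx'
    rw [(hsum x).tsum_eq_zero_add, B.map_tsum (hsum (Φ x))]
    simp only [Function.iterate_zero, id_eq, hx, hx', Function.iterate_succ_apply']
    rfl

end CohomologicalEquation

/-- Orbits along which a Lyapunov function increases by a definite amount contract exponentially as
long as the Lyapunov function is nonpositive. -/
theorem exists_norm_iterate_le_of_lyapunov {E : Type*} [NormedAddCommGroup E] {f : E → E}
    {q : E → ℝ} {δ C L : ℝ} (hδ : 0 < δ) (hL : 0 ≤ L) (hq : ∀ x, |q x| ≤ C * ‖x‖ ^ 2)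
    (hf : ∀ x, ‖f x‖ ≤ L * ‖x‖) (hqf : ∀ x, q x + δ * ‖x‖ ^ 2 ≤ q (f x)) :
    ∃ c μ : ℝ, 0 ≤ c ∧ 0 ≤ μ ∧ μ < 1 ∧
      ∀ k x, q (f^[k] x) ≤ 0 → ‖f^[k] x‖ ≤ c * μ ^ k * ‖x‖ := by
  set D := max C (2 * δ) with hD
  have hDC : C ≤ D := le_max_left _ _
  have hDδ : 2 * δ ≤ D := le_max_right _ _
  have hDpos : 0 < D := by linarith
  set κ := 1 - δ / D with hκ
  have hδD : δ / D ≤ 1 / 2 := by rw [div_le_iff₀ hDpos]; linarith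
  have hδD0 : 0 < δ / D := by positivity
  have hκpos : 0 < κ := by linarith
  have hqD : ∀ x, -q x ≤ D * ‖x‖ ^ 2 := fun x =>
    (neg_le_abs _).trans ((hq x).trans (by gcongr))
  have hmono : ∀ x, q x ≤ q (f x) := fun x => by
    have := hqf x
    have : 0 ≤ δ * ‖x‖ ^ 2 := by positivity
    linarith
  have hstep : ∀ x, -q (f x) ≤ κ * -q x := by
    intro x
    have h1 := hqf x
    have h2 : δ / D * -q x ≤ δ * ‖x‖ ^ 2 := by
      calc δ / D * -q x ≤ δ / D * (D * ‖x‖ ^ 2) := by gcongr; exact hqD x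
        _ = δ * ‖x‖ ^ 2 := by field_simp
    rw [hκ, sub_mul]
    linarith
  have hiter : ∀ k x, -q (f^[k] x) ≤ κ ^ k * -q x := by
    intro k
    induction k with
    | zero => intro x; simp
    | succ k ih =>
      intro x
      rw [Function.iterate_succ_apply', pow_succ', mul_assoc]
      exact (hstep _).trans (by gcongr; exact ih x)
  set μ := √κ with hμ
  have hμpos : 0 < μ := Real.sqrt_pos.2 hκpos
  have hμsq : μ ^ 2 = κ := Real.sq_sqrt hκpos.le
  refine ⟨1 + L * √(D / δ) / μ, μ, by positivity, hμpos.le, ?_, fun k x hk => ?_⟩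
  · rw [hμ, Real.sqrt_lt' one_pos]
    linarith
  · rcases k with _ | k
    · simp only [Function.iterate_zero, id_eq, pow_zero, mul_one]
      exact le_mul_of_one_le_left (norm_nonneg _) (le_add_of_nonneg_right (by positivity))
    · rw [Function.iterate_succ_apply'] at hk ⊢
      have h1 : δ * ‖f^[k] x‖ ^ 2 ≤ κ ^ k * (D * ‖x‖ ^ 2) := by
        calc δ * ‖f^[k] x‖ ^ 2 ≤ -q (f^[k] x) := by linarith [hqf (f^[k] x)]
          _ ≤ κ ^ k * -q x := hiter k x
          _ ≤ κ ^ k * (D * ‖x‖ ^ 2) := by gcongr; exact hqD x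
      have h2 : ‖f^[k] x‖ ≤ √(D / δ) * μ ^ k * ‖x‖ := by
        refine (sq_le_sq₀ (norm_nonneg _) (by positivity)).1 ?_
        rw [mul_pow, mul_pow, Real.sq_sqrt (by positivity), ← pow_mul, mul_comm k 2, pow_mul, hμsq]
        rw [← mul_le_mul_iff_right₀ hδ]
        refine h1.trans (le_of_eq ?_)
        field_simp
      calc ‖f (f^[k] x)‖ ≤ L * (√(D / δ) * μ ^ k * ‖x‖) := (hf _).trans (by gcongr)
        _ = L * √(D / δ) / μ * μ ^ (k + 1) * ‖x‖ := by rw [pow_succ]; field_simp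
        _ ≤ _ := by gcongr; linarith

section Taylor

open Filter Asymptotics Topology

variable {E F : Type*} [NormedAddCommGroup E] [NormedSpace ℝ E]
  [NormedAddCommGroup F] [NormedSpace ℝ F]

/-- Taylor's theorem at the origin with a big-`O` remainder. -/
theorem ContDiff.sub_taylor_isBigO [CompleteSpace F] {f : E → F} (hf : ContDiff ℝ ∞ f) (m : ℕ) :
    (fun x => f x - ∑ k ∈ Finset.range (m + 1),
      (k.factorial : ℝ)⁻¹ • iteratedFDeriv ℝ k f 0 fun _ => x) =O[𝓝 0] fun x => ‖x‖ ^ (m + 1) := by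
  have hc : Continuous (iteratedFDeriv ℝ (m + 1) f) :=
    hf.continuous_iteratedFDeriv (by exact_mod_cast le_top)
  set C := ‖iteratedFDeriv ℝ (m + 1) f 0‖ + 1 with hC
  have hC0 : 0 ≤ C := by positivity
  have h1 : ∀ᶠ x in 𝓝 0, ‖iteratedFDeriv ℝ (m + 1) f x‖ < C :=
    (hc.norm.tendsto 0).eventually (gt_mem_nhds (lt_add_one _))
  obtain ⟨r, hr, hrC⟩ := Metric.eventually_nhds_iff_ball.1 h1
  refine IsBigO.of_bound ((m.factorial : ℝ)⁻¹ * C) ?_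
  filter_upwards [Metric.ball_mem_nhds (0 : E) hr] with x hx
  have h2 := map_add_eq_sum_add_integral_iteratedFDeriv (f := f) (x := 0) (y := x) (n := m)
    fun t _ => hf.contDiffAt.of_le (by exact_mod_cast le_top)
  rw [zero_add] at h2
  rw [h2, add_sub_cancel_left, norm_smul, Real.norm_of_nonneg (by positivity), mul_assoc,
    norm_pow, norm_norm]
  gcongr
  have h3 : ∀ t ∈ Set.uIoc (0 : ℝ) 1,
      ‖(1 - t) ^ m • iteratedFDeriv ℝ (m + 1) f (0 + t • x) (fun _ => x)‖ ≤
        C * ‖x‖ ^ (m + 1) := by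
    intro t ht
    rw [Set.uIoc_of_le zero_le_one] at ht
    have ht1 : ‖(1 - t) ^ m‖ ≤ 1 := by
      rw [norm_pow, Real.norm_of_nonneg (by linarith [ht.2])]
      exact pow_le_one₀ (by linarith [ht.2]) (by linarith [ht.1])
    have htx : 0 + t • x ∈ Metric.ball (0 : E) r := by
      rw [zero_add, mem_ball_zero_iff, norm_smul, Real.norm_of_nonneg ht.1.le]
      rw [mem_ball_zero_iff] at hx
      exact (mul_le_of_le_one_left (norm_nonneg _) ht.2).trans_lt hx
    rw [norm_smul, ← one_mul (C * _)]
    gcongr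
    refine (ContinuousMultilinearMap.le_opNorm _ _).trans ?_
    rw [Finset.prod_const, Finset.card_univ, Fintype.card_fin]
    gcongr
    exact (hrC _ htx).le
  simpa using intervalIntegral.norm_integral_le_of_norm_le_const h3

/-- A homogeneous polynomial of degree `m` that is `O(‖x‖ ^ (m + 1))` at the origin vanishes. -/
theorem ContinuousMultilinearMap.diag_eq_zero_of_isBigO {m : ℕ}
    (M : ContinuousMultilinearMap ℝ (fun _ : Fin m => E) F)
    (hM : (fun x => M fun _ => x) =O[𝓝 0] fun x => ‖x‖ ^ (m + 1)) (x : E) :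
    (M fun _ => x) = 0 := by
  obtain ⟨C, hC⟩ := hM.bound
  have h1 : Tendsto (fun t : ℝ => t • x) (𝓝[>] 0) (𝓝 0) := by
    have : Continuous fun t : ℝ => t • x := by fun_prop
    simpa using (this.tendsto 0).mono_left nhdsWithin_le_nhds
  have h2 : ∀ᶠ t : ℝ in 𝓝[>] 0, ‖M fun _ => x‖ ≤ t * (C * ‖x‖ ^ (m + 1)) := by
    filter_upwards [h1.eventually hC, self_mem_nhdsWithin] with t ht ht0
    have ht0 : 0 < t := ht0
    have h3 : (M fun _ => t • x) = t ^ m • M fun _ => x := by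
      simpa using M.map_smul_univ (fun _ => t) (fun _ => x)
    rw [h3, norm_smul, norm_pow, norm_pow, norm_norm, norm_smul, Real.norm_of_nonneg ht0.le] at ht
    refine le_of_mul_le_mul_left (ht.trans (le_of_eq ?_)) (pow_pos ht0 m)
    ring
  have h4 : Tendsto (fun t : ℝ => t * (C * ‖x‖ ^ (m + 1))) (𝓝[>] 0) (𝓝 0) := by
    have : Continuous fun t : ℝ => t * (C * ‖x‖ ^ (m + 1)) := by fun_prop
    simpa using (this.tendsto 0).mono_left nhdsWithin_le_nhds
  exact norm_le_zero_iff.1 (ge_of_tendsto h4 h2)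

/-- The leading homogeneous part of a smooth function vanishing to order `m` at the origin. -/
theorem ContDiff.exists_leading_part [CompleteSpace F] {f : E → F} (hf : ContDiff ℝ ∞ f) (m : ℕ)
    (hfm : f =O[𝓝 0] fun x => ‖x‖ ^ m) :
    ∃ Q : ContinuousMultilinearMap ℝ (fun _ : Fin m => E) F,
      (fun x => f x - Q fun _ => x) =O[𝓝 0] fun x => ‖x‖ ^ (m + 1) := by
  have key : ∀ m : ℕ, (f =O[𝓝 0] fun x => ‖x‖ ^ m) →
      ∀ k < m, ∀ x, (iteratedFDeriv ℝ k f 0 fun _ => x) = 0 := by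
    intro m
    induction m with
    | zero => intro _ k hk; omega
    | succ m ih =>
      intro h k hk x
      have ih' := ih (isBigO_norm_pow_of_le m.le_succ h)
      rcases Nat.lt_succ_iff_lt_or_eq.1 hk with hk | rfl
      · exact ih' k hk x
      · refine ContinuousMultilinearMap.diag_eq_zero_of_isBigO _ ?_ x
        have h1 := h.sub (hf.sub_taylor_isBigO k)
        simp only [sub_sub_cancel] at h1
        refine (h1.const_smul_left (k.factorial : ℝ)).congr_left fun y => ?_
        rw [Pi.smul_apply, Finset.sum_range_succ, Finset.sum_eq_zero fun l hl => ?_, zero_add,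
          smul_inv_smul₀ (by positivity)]
        rw [ih' l (Finset.mem_range.1 hl), smul_zero]
  refine ⟨(m.factorial : ℝ)⁻¹ • iteratedFDeriv ℝ m f 0, ?_⟩
  refine (hf.sub_taylor_isBigO m).congr_left fun x => ?_
  rw [Finset.sum_range_succ, Finset.sum_eq_zero fun l hl => ?_, zero_add]
  · rfl
  · rw [key m hfm l (Finset.mem_range.1 hl), smul_zero]

end Taylor

section FormalSolutions

open Filter Asymptotics Topology

variable {E F : Type*} [NormedAddCommGroup E] [NormedSpace ℝ E]
  [NormedAddCommGroup F] [NormedSpace ℝ F]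

theorem ContinuousMultilinearMap.contDiff_diag {m : ℕ}
    (M : ContinuousMultilinearMap ℝ (fun _ : Fin m => E) F) :
    ContDiff ℝ ∞ fun x => M fun _ => x :=
  M.contDiff.comp (contDiff_pi.2 fun _ => contDiff_id)

theorem ContinuousMultilinearMap.norm_diag_le {m : ℕ}
    (M : ContinuousMultilinearMap ℝ (fun _ : Fin m => E) F) (x : E) :
    ‖M fun _ => x‖ ≤ ‖M‖ * ‖x‖ ^ m := by
  simpa using M.le_opNorm fun _ => x

theorem ContinuousMultilinearMap.diag_isBigO {m : ℕ}
    (M : ContinuousMultilinearMap ℝ (fun _ : Fin m => E) F) :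
    (fun x => M fun _ => x) =O[𝓝 0] fun x => ‖x‖ ^ m :=
  IsBigO.of_bound ‖M‖ (Eventually.of_forall fun x => by simpa using M.norm_diag_le x)

theorem ContinuousMultilinearMap.diag_sub_diag_isBigO {m : ℕ}
    (M : ContinuousMultilinearMap ℝ (fun _ : Fin (m + 1) => E) F) {f g : E → E}
    (hf : f =O[𝓝 0] fun x => x) (hg : g =O[𝓝 0] fun x => x)
    (hfg : (fun x => f x - g x) =O[𝓝 0] fun x => ‖x‖ ^ 2) :
    (fun x => (M fun _ => f x) - M fun _ => g x) =O[𝓝 0] fun x => ‖x‖ ^ (m + 2) := by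
  obtain ⟨C, hC0, hC⟩ := hf.exists_nonneg
  obtain ⟨D, hD0, hD⟩ := hg.exists_nonneg
  obtain ⟨K, hK0, hK⟩ := hfg.exists_nonneg
  refine IsBigO.of_bound (‖M‖ * ↑(m + 1) * max C D ^ m * K) ?_
  filter_upwards [hC.bound, hD.bound, hK.bound] with x h1 h2 h3
  have h4 := M.norm_image_sub_le (fun _ => f x) fun _ => g x
  have h5 : (fun _ : Fin (m + 1) => f x) - (fun _ => g x) = fun _ => f x - g x := rfl
  rw [h5, pi_norm_const, pi_norm_const, pi_norm_const, Fintype.card_fin,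
    Nat.add_sub_cancel] at h4
  rw [norm_pow, norm_norm] at h3 ⊢
  have h6 : max ‖f x‖ ‖g x‖ ≤ max C D * ‖x‖ := max_le
    (h1.trans (by gcongr; exact le_max_left _ _)) (h2.trans (by gcongr; exact le_max_right _ _))
  have h7 : 0 ≤ max C D := hC0.trans (le_max_left _ _)
  calc _ ≤ ‖M‖ * ↑(m + 1) * (max C D * ‖x‖) ^ m * (K * ‖x‖ ^ 2) := by
        refine h4.trans ?_
        gcongr
    _ = _ := by rw [mul_pow, pow_add]; ring

/-- A homogeneous polynomial agrees near the origin with a smooth function all of whose derivatives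
of lower order are small. -/
theorem ContinuousMultilinearMap.exists_small_cutoff [FiniteDimensional ℝ E] {k : ℕ}
    (M : ContinuousMultilinearMap ℝ (fun _ : Fin (k + 1) => E) F) {ε : ℝ} (hε : 0 < ε) :
    ∃ u : E → F, ContDiff ℝ ∞ u ∧ (∀ᶠ x in 𝓝 0, u x = M fun _ => x) ∧
      (∀ x, ‖u x‖ ≤ ε * ‖x‖ ^ k) ∧ ∀ i ≤ k, ∀ x, ‖iteratedFDeriv ℝ i u x‖ ≤ ε := by
  let b : ContDiffBump (0 : E) := ⟨1 / 2, 1, by norm_num, by norm_num⟩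
  set w : E → F := fun x => b x • M fun _ => x with hw
  have hws : ContDiff ℝ ∞ w := b.contDiff.smul M.contDiff_diag
  have hsupp : HasCompactSupport w := b.hasCompactSupport.smul_right
  have hwb : ∀ i : ℕ, ∃ C, ∀ x, ‖iteratedFDeriv ℝ i w x‖ ≤ C := fun i =>
    (hws.continuous_iteratedFDeriv (by exact_mod_cast le_top)).bounded_above_of_compact_support
      (hsupp.iteratedFDeriv i)
  choose C hC using hwb
  set D := ∑ i ∈ Finset.range (k + 1), |C i| with hD
  have hD0 : 0 ≤ D := by positivity
  set t := 1 + (D + ‖M‖) / ε with ht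
  have ht1 : 1 ≤ t := le_add_of_nonneg_right (by positivity)
  have ht0 : 0 < t := by linarith
  have htε : D + ‖M‖ ≤ t * ε := by
    rw [ht, add_mul, div_mul_cancel₀ _ hε.ne']
    linarith
  have hM0 := norm_nonneg M
  have hu : (fun x => b (t • x) • M fun _ => x) = (t ^ (k + 1))⁻¹ • fun x => w (t • x) := by
    ext1 x
    have h3 : (M fun _ => t • x) = t ^ (k + 1) • M fun _ => x := by
      simpa using M.map_smul_univ (fun _ => t) (fun _ => x)
    rw [Pi.smul_apply, hw]
    simp only
    rw [h3, smul_comm (b (t • x)), inv_smul_smul₀ (by positivity)]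
  have hws' : ContDiff ℝ ∞ fun x => w (t • x) := hws.comp (contDiff_id.const_smul t)
  refine ⟨fun x => b (t • x) • M fun _ => x, ?_, ?_, fun x => ?_, fun i hi x => ?_⟩
  · rw [hu]
    exact contDiff_const.smul hws'
  · have : Tendsto (fun x : E => t • x) (𝓝 0) (𝓝 0) := by
      have h : Continuous fun x : E => t • x := by fun_prop
      simpa using h.tendsto 0
    filter_upwards [this.eventually b.eventuallyEq_one] with x hx
    simp [hx]
  · by_cases hx : ‖t • x‖ ≤ 1
    · rw [norm_smul, Real.norm_of_nonneg ht0.le] at hx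
      rw [norm_smul, Real.norm_of_nonneg b.nonneg]
      calc b (t • x) * ‖M fun _ => x‖ ≤ 1 * (‖M‖ * ‖x‖ ^ (k + 1)) := by
            gcongr
            · exact b.le_one
            · exact M.norm_diag_le x
        _ = ‖M‖ * ‖x‖ * ‖x‖ ^ k := by rw [pow_succ]; ring
        _ ≤ t * ε * ‖x‖ * ‖x‖ ^ k := by gcongr; linarith
        _ = ε * (t * ‖x‖) * ‖x‖ ^ k := by ring
        _ ≤ ε * 1 * ‖x‖ ^ k := by gcongr
        _ = _ := by ring
    · have : b (t • x) = 0 := b.zero_of_le_dist (by simpa using (not_le.1 hx).le)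
      change ‖b (t • x) • M fun _ => x‖ ≤ _
      rw [this, zero_smul, norm_zero]
      positivity
  · rw [hu, iteratedFDeriv_const_smul_apply (hws'.of_le (by exact_mod_cast le_top)).contDiffAt,
      iteratedFDeriv_comp_const_smul t (hws.of_le (by exact_mod_cast le_top)), norm_smul, norm_smul,
      Real.norm_of_nonneg (by positivity), Real.norm_of_nonneg (by positivity)]
    have h1 : ‖iteratedFDeriv ℝ i w (t • x)‖ ≤ t * ε :=
      calc _ ≤ |C i| := (hC i _).trans (le_abs_self _)
        _ ≤ D := Finset.single_le_sum (f := fun i => |C i|) (fun _ _ => abs_nonneg _)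
          (Finset.mem_range.2 (by omega))
        _ ≤ t * ε := by linarith
    calc (t ^ (k + 1))⁻¹ * (t ^ i * ‖iteratedFDeriv ℝ i w (t • x)‖)
        ≤ (t ^ (k + 1))⁻¹ * (t ^ k * (t * ε)) := by gcongr
      _ = ε := by rw [pow_succ]; field_simp

/-- **Borel's theorem**: every formal power series without terms of degree less than two is the
Taylor series of a smooth function. -/
theorem exists_contDiff_sub_sum_isBigO [FiniteDimensional ℝ E] [CompleteSpace F]
    (M : ∀ k : ℕ, ContinuousMultilinearMap ℝ (fun _ : Fin (k + 2) => E) F) :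
    ∃ f : E → F, ContDiff ℝ ∞ f ∧ ∀ N : ℕ,
      (fun x => f x - ∑ k ∈ Finset.range N, M k fun _ => x) =O[𝓝 0] fun x => ‖x‖ ^ (N + 1) := by
  choose u hus hu hub hud using fun k : ℕ =>
    (M k).exists_small_cutoff (ε := (1 / 2) ^ k) (by positivity)
  refine ⟨fun x => ∑' k, u k x, ?_, fun N => ?_⟩
  · refine contDiff_tsum_of_eventually (v := fun _ k => (1 / 2) ^ k) hus
      (fun _ _ => summable_geometric_two) fun i _ => ?_
    rw [Nat.cofinite_eq_atTop]
    filter_upwards [eventually_ge_atTop i] with k hk x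
    exact hud k i (by omega) x
  · refine IsBigO.of_bound 2 ?_
    have h1 : ∀ᶠ x in 𝓝 0, ∀ k ∈ Finset.range N, u k x = M k fun _ => x :=
      (Finset.eventually_all _).2 fun k _ => hu k
    filter_upwards [h1, Metric.closedBall_mem_nhds (0 : E) one_pos] with x hx hx1
    rw [mem_closedBall_zero_iff] at hx1
    have hsum : Summable fun k => u k x := by
      refine Summable.of_norm_bounded summable_geometric_two fun k => ?_
      exact (hub k x).trans (mul_le_of_le_one_right (by positivity)
        (pow_le_one₀ (norm_nonneg _) hx1))
    rw [← hsum.sum_add_tsum_nat_add N, Finset.sum_congr rfl hx, add_sub_cancel_left, norm_pow,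
      norm_norm]
    refine tsum_of_norm_bounded (hasSum_geometric_two.mul_right _) fun k => ?_
    refine (hub (k + N) x).trans ?_
    gcongr ?_ * ?_
    · exact pow_le_pow_of_le_one (by norm_num) (by norm_num) (by omega)
    · exact pow_le_pow_of_le_one (norm_nonneg _) hx1 (by omega)

/-- Formal linearisation: if all homological equations are solvable, then `Φ` is linearised to
infinite order at the origin by a smooth map tangent to the identity. -/
theorem exists_flat_linearisation_defect [FiniteDimensional ℝ E] {Φ : E → E} (hΦ : ContDiff ℝ ∞ Φ)
    (A : E →L[ℝ] E) (hA : (fun x => Φ x - A x) =O[𝓝 0] fun x => ‖x‖ ^ 2)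
    (hsolve : ∀ (k : ℕ) (Q : ContinuousMultilinearMap ℝ (fun _ : Fin (k + 2) => E) E),
      ∃ M : ContinuousMultilinearMap ℝ (fun _ : Fin (k + 2) => E) E,
        ∀ v, M (fun i => A (v i)) - A (M v) = Q v) :
    ∃ ψ : E → E, ContDiff ℝ ∞ ψ ∧ (fun x => ψ x - x) =O[𝓝 0] (fun x => ‖x‖ ^ 2) ∧
      IsFlatAtZero fun x => ψ (Φ x) - A (ψ x) := by
  have : CompleteSpace E := FiniteDimensional.complete ℝ E
  have hAO : (fun x => A x) =O[𝓝 0] fun x : E => x := A.isBigO_id _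
  have hΦO : Φ =O[𝓝 0] fun x : E => x := by
    have h1 : (fun x : E => ‖x‖ ^ 2) =O[𝓝 0] fun x : E => x := by
      refine IsBigO.of_norm_right ?_
      simpa using isBigO_norm_pow_of_le one_le_two (isBigO_refl (fun x : E => ‖x‖ ^ 2) (𝓝 0))
    simpa using (hA.trans h1).add hAO
  have hstep : ∀ (N : ℕ) (p : E → E), ∃ M : ContinuousMultilinearMap ℝ (fun _ : Fin (N + 2) => E) E,
      ContDiff ℝ ∞ p → ((fun x => p (Φ x) - A (p x)) =O[𝓝 0] fun x => ‖x‖ ^ (N + 2)) →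
      (fun x => (p (Φ x) + M fun _ => Φ x) - A (p x + M fun _ => x)) =O[𝓝 0]
        fun x => ‖x‖ ^ (N + 3) := by
    intro N p
    by_cases hp : ContDiff ℝ ∞ p ∧ (fun x => p (Φ x) - A (p x)) =O[𝓝 0] fun x => ‖x‖ ^ (N + 2)
    · obtain ⟨hps, hp⟩ := hp
      obtain ⟨Q, hQ⟩ := ContDiff.exists_leading_part
        ((hps.comp hΦ).sub (A.contDiff.comp hps)) (N + 2) hp
      obtain ⟨M, hM⟩ := hsolve N (-Q)
      refine ⟨M, fun _ _ => ?_⟩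
      refine (hQ.add (M.diag_sub_diag_isBigO hΦO hAO hA)).congr_left fun x => ?_
      have h1 := hM fun _ => x
      rw [neg_apply, eq_neg_iff_add_eq_zero] at h1
      rw [map_add, ← sub_eq_zero, ← neg_eq_zero, ← h1]
      simp only [Function.comp_apply]
      abel
    · exact ⟨0, fun h1 h2 => absurd ⟨h1, h2⟩ hp⟩
  choose M hM using hstep
  let p : ℕ → E → E := fun N => Nat.rec id (fun N p x => p x + M N p fun _ => x) N
  have hp : ∀ N, ContDiff ℝ ∞ (p N) ∧
      (fun x => p N (Φ x) - A (p N x)) =O[𝓝 0] fun x => ‖x‖ ^ (N + 2) := by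
    intro N
    induction N with
    | zero => exact ⟨contDiff_id, hA⟩
    | succ N ih => exact ⟨ih.1.add (M N (p N)).contDiff_diag, hM N (p N) ih.1 ih.2⟩
  have hpsum : ∀ N x, p N x = x + ∑ k ∈ Finset.range N, M k (p k) fun _ => x := by
    intro N x
    induction N with
    | zero => simp [p]
    | succ N ih => rw [Finset.sum_range_succ, ← add_assoc, ← ih]
  obtain ⟨f, hf, hfM⟩ := exists_contDiff_sub_sum_isBigO fun k => M k (p k)
  refine ⟨fun x => x + f x, contDiff_id.add hf, ?_, fun N => ?_⟩
  · refine ((hfM 1).add (M 0 (p 0)).diag_isBigO).congr_left fun x => ?_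
    simp
  · have h1 : (fun x => x + f x - p N x) =O[𝓝 0] fun x => ‖x‖ ^ (N + 1) := by
      refine (hfM N).congr_left fun x => ?_
      rw [hpsum]
      abel
    have hΦ0 : Tendsto Φ (𝓝 0) (𝓝 0) := hΦO.trans_tendsto tendsto_id
    have h2 : (fun x => Φ x + f (Φ x) - p N (Φ x)) =O[𝓝 0] fun x => ‖x‖ ^ (N + 1) :=
      (h1.comp_tendsto hΦ0).trans (hΦO.norm_norm.pow _)
    have h3 : (fun x => A (x + f x - p N x)) =O[𝓝 0] fun x => ‖x‖ ^ (N + 1) :=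
      (A.isBigO_comp _ _).trans h1
    refine isBigO_norm_pow_of_le N.le_succ ?_
    refine ((h2.sub h3).add (isBigO_norm_pow_of_le (N + 1).le_succ (hp N).2)).congr_left fun x => ?_
    change _ = Φ x + f (Φ x) - A (x + f x)
    rw [map_sub]
    abel

end FormalSolutions

section Globalisation

open Filter Asymptotics Topology

variable {E : Type*} [NormedAddCommGroup E] [NormedSpace ℝ E]

theorem ContinuousLinearMap.exists_norm_iteratedFDeriv_le (A : E →L[ℝ] E) {i : ℕ} (hi : 1 ≤ i) :
    ∃ C, ∀ x, ‖iteratedFDeriv ℝ i A x‖ ≤ C := by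
  obtain ⟨i, rfl⟩ := Nat.exists_eq_add_of_le' hi
  refine ⟨‖A‖, fun x => ?_⟩
  have h1 : fderiv ℝ A = fun _ => A := funext fun x => A.fderiv
  rw [← norm_iteratedFDeriv_fderiv, h1]
  rcases i with _ | i
  · rw [norm_iteratedFDeriv_zero]
  · rw [iteratedFDeriv_const_of_ne i.succ_ne_zero, Pi.zero_apply, norm_zero]
    exact norm_nonneg A

/-- A local smooth map is, near the origin, the restriction of a global one which is uniformly close
to the linear part and has bounded derivatives. -/
theorem ContDiffOn.exists_global_extension [FiniteDimensional ℝ E] {f : E → E} {U : Set E}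
    (hf : ContDiffOn ℝ ∞ f U) (hU : IsOpen U) (h0 : 0 ∈ U) (hf0 : f 0 = 0) {A : E →L[ℝ] E}
    (hA : HasFDerivAt f A 0) {ε : ℝ} (hε : 0 < ε) :
    ∃ Φ : E → E, ContDiff ℝ ∞ Φ ∧ Φ =ᶠ[𝓝 0] f ∧ (∀ x, ‖Φ x - A x‖ ≤ ε * ‖x‖) ∧
      ∀ i, 1 ≤ i → ∃ C, ∀ x, ‖iteratedFDeriv ℝ i Φ x‖ ≤ C := by
  have h1 : ∀ᶠ x in 𝓝 0, ‖f x - A x‖ ≤ ε * ‖x‖ := by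
    simpa [hf0] using hA.isLittleO.bound hε
  obtain ⟨r, hr, hrU⟩ := Metric.mem_nhds_iff.1 (inter_mem (hU.mem_nhds h0) h1)
  let b : ContDiffBump (0 : E) := ⟨r / 4, r / 2, by positivity, by linarith⟩
  set w : E → E := fun x => b x • (f x - A x) with hw
  have hws : ContDiff ℝ ∞ w := by
    refine contDiff_iff_contDiffAt.2 fun x => ?_
    by_cases hx : x ∈ Metric.ball (0 : E) r
    · exact b.contDiffAt.smul ((hf.contDiffAt (hU.mem_nhds (hrU hx).1)).sub A.contDiff.contDiffAt)
    · have hx' : x ∈ (Metric.closedBall (0 : E) (r / 2))ᶜ := fun h =>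
        hx (Metric.closedBall_subset_ball (by linarith) h)
      refine (contDiffAt_const (c := (0 : E))).congr_of_eventuallyEq ?_
      filter_upwards [Metric.isClosed_closedBall.isOpen_compl.mem_nhds hx'] with y hy
      rw [Set.mem_compl_iff, Metric.mem_closedBall, not_le] at hy
      have : b y = 0 := b.zero_of_le_dist hy.le
      simp [hw, this]
  have hsupp : HasCompactSupport w := b.hasCompactSupport.smul_right
  refine ⟨fun x => A x + w x, A.contDiff.add hws, ?_, fun x => ?_, fun i hi => ?_⟩
  · filter_upwards [b.eventuallyEq_one] with x hx
    simp [hw, hx]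
  · rw [add_sub_cancel_left]
    by_cases hx : x ∈ Metric.ball (0 : E) r
    · rw [hw, norm_smul, Real.norm_of_nonneg b.nonneg]
      exact (mul_le_of_le_one_left (norm_nonneg _) b.le_one).trans (hrU hx).2
    · rw [Metric.mem_ball, not_lt] at hx
      have : b x = 0 := b.zero_of_le_dist (le_trans (by change r / 2 ≤ r; linarith) hx)
      change ‖b x • (f x - A x)‖ ≤ _
      rw [this, zero_smul, norm_zero]
      positivity
  · obtain ⟨C, hC⟩ := A.exists_norm_iteratedFDeriv_le hi
    obtain ⟨D, hD⟩ := (hws.continuous_iteratedFDeriv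
      (m := i) (by exact_mod_cast le_top)).bounded_above_of_compact_support (hsupp.iteratedFDeriv i)
    refine ⟨C + D, fun x => ?_⟩
    rw [fun_iteratedFDeriv_add_apply A.contDiff.contDiffAt
      (hws.of_le (by exact_mod_cast le_top)).contDiffAt]
    exact (norm_add_le _ _).trans (add_le_add (hC x) (hD x))

theorem ContDiff.sub_fderiv_isBigO [CompleteSpace E] {Φ : E → E} (hΦ : ContDiff ℝ ∞ Φ)
    (hΦ0 : Φ 0 = 0) {A : E →L[ℝ] E} (hA : HasFDerivAt Φ A 0) :
    (fun x => Φ x - A x) =O[𝓝 0] fun x => ‖x‖ ^ 2 := by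
  refine (hΦ.sub_taylor_isBigO 1).congr_left fun x => ?_
  simp [Finset.sum_range_succ, hΦ0, iteratedFDeriv_one_apply, hA.fderiv]

/-- A quadratic form that increases along the linear map `B` yields Lyapunov functions for all
nonlinear perturbations of `B`. -/
theorem exists_lyapunov_of_quadratic (B : E →L[ℝ] E)
    (Q : ContinuousMultilinearMap ℝ (fun _ : Fin 2 => E) ℝ) {θ : ℝ} (hθ : 0 < θ)
    (hQ : ∀ x, (Q fun _ => x) + θ * ‖x‖ ^ 2 ≤ Q fun _ => B x) :
    ∃ ε₀ : ℝ, 0 < ε₀ ∧ ∀ ε : ℝ, 0 ≤ ε → ε ≤ ε₀ → ∀ f : E → E, (∀ x, ‖f x - B x‖ ≤ ε * ‖x‖) →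
      ∀ x, (Q fun _ => x) - ε * ‖x‖ ^ 2 + θ / 2 * ‖x‖ ^ 2 ≤ (Q fun _ => f x) - ε * ‖f x‖ ^ 2 := by
  set K := ‖B‖ + 1 with hK
  have hK1 : 1 ≤ K := le_add_of_nonneg_left (norm_nonneg _)
  have hQ0 := norm_nonneg Q
  set D := ‖Q‖ * 2 * K + K ^ 2 with hD
  have hDpos : 0 < D := by positivity
  refine ⟨min 1 (θ / (2 * D)), by positivity, fun ε hε0 hε f hf x => ?_⟩
  have hε1 : ε ≤ 1 := hε.trans (min_le_left _ _)
  have hεD : ε * D ≤ θ / 2 := by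
    have := hε.trans (min_le_right _ _)
    rw [le_div_iff₀ (by positivity)] at this
    linarith
  have h1 : ‖B x‖ ≤ K * ‖x‖ := (B.le_opNorm x).trans (by gcongr; linarith)
  have h2 : ‖f x‖ ≤ K * ‖x‖ := by
    calc ‖f x‖ = ‖(f x - B x) + B x‖ := by rw [sub_add_cancel]
      _ ≤ ε * ‖x‖ + ‖B‖ * ‖x‖ := (norm_add_le _ _).trans (add_le_add (hf x) (B.le_opNorm x))
      _ ≤ 1 * ‖x‖ + ‖B‖ * ‖x‖ := by gcongr
      _ = K * ‖x‖ := by rw [hK]; ring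
  have h3 := Q.norm_image_sub_le (fun _ => f x) fun _ => B x
  have h5 : (fun _ : Fin 2 => f x) - (fun _ => B x) = fun _ => f x - B x := rfl
  rw [h5, pi_norm_const, pi_norm_const, pi_norm_const, Fintype.card_fin] at h3
  have h4 : ‖(Q fun _ => f x) - Q fun _ => B x‖ ≤ ‖Q‖ * 2 * (K * ‖x‖) ^ 1 * (ε * ‖x‖) := by
    refine h3.trans ?_
    push_cast
    gcongr
    · exact max_le h2 h1
    · exact hf x
  have h6 : ε * ‖f x‖ ^ 2 ≤ ε * (K * ‖x‖) ^ 2 := by gcongr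
  have h7 : ε * D * ‖x‖ ^ 2 ≤ θ / 2 * ‖x‖ ^ 2 := by gcongr
  have h8 : 0 ≤ ε * ‖x‖ ^ 2 := by positivity
  have h9 := (abs_le.1 h4).1
  have h10 := hQ x
  have h11 : ε * D * ‖x‖ ^ 2 = ‖Q‖ * 2 * (K * ‖x‖) ^ 1 * (ε * ‖x‖) + ε * (K * ‖x‖) ^ 2 := by
    rw [hD]; ring
  linarith

end Globalisation

section Splitting

open Filter Asymptotics Topology

variable {E F : Type*} [NormedAddCommGroup E] [InnerProductSpace ℝ E] [FiniteDimensional ℝ E]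
  [NormedAddCommGroup F] [NormedSpace ℝ F]

/-- A flat function splits into flat functions supported in two cones that are described by a
quadratic form. -/
theorem IsFlatAtZero.exists_cone_splitting {g : E → F} (hg : IsFlatAtZero g)
    (hgs : ContDiff ℝ ∞ g) (Q : ContinuousMultilinearMap ℝ (fun _ : Fin 2 => E) ℝ) {η : ℝ}
    (hη : 0 < η) :
    ∃ g₁ g₂ : E → F, ContDiff ℝ ∞ g₁ ∧ ContDiff ℝ ∞ g₂ ∧ IsFlatAtZero g₁ ∧ IsFlatAtZero g₂ ∧
      (∀ x, g x = g₁ x + g₂ x) ∧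
      (∀ i x, _root_.iteratedFDeriv ℝ i g₁ x ≠ 0 → (Q fun _ => x) - η * ‖x‖ ^ 2 ≤ 0) ∧
      ∀ i x, _root_.iteratedFDeriv ℝ i g₂ x ≠ 0 → (-Q fun _ => x) - η * ‖x‖ ^ 2 ≤ 0 := by
  set u : E → ℝ := fun x =>
    Real.smoothTransition (1 / 2 - (Q fun _ => x) / (2 * η * ‖x‖ ^ 2)) with hu
  have hus : ∀ x, x ≠ 0 → ContDiffAt ℝ ∞ u x := by
    intro x hx
    have hx' : 2 * η * ‖x‖ ^ 2 ≠ 0 := by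
      have := norm_pos_iff.2 hx
      positivity
    exact Real.smoothTransition.contDiff.contDiffAt.comp x (contDiffAt_const.sub
      (Q.contDiff_diag.contDiffAt.div (contDiffAt_const.mul (contDiff_norm_sq ℝ).contDiffAt) hx'))
  have huh : ∀ t : ℝ, 0 < t → ∀ x, u (t • x) = u x := by
    intro t ht x
    have h3 : (Q fun _ => t • x) = t ^ 2 • Q fun _ => x := by
      simpa using Q.map_smul_univ (fun _ => t) (fun _ => x)
    simp only [hu]
    rw [h3, norm_smul, Real.norm_of_nonneg ht.le, mul_pow, smul_eq_mul, mul_left_comm,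
      mul_div_mul_left _ _ (by positivity)]
  have hg₁s := hg.contDiff_homogeneous_smul hgs hus huh
  have hg₁ : IsFlatAtZero fun x => u x • g x := by
    refine fun N => IsBigO.trans (IsBigO.of_bound 1 (Eventually.of_forall fun x => ?_)) (hg N)
    rw [norm_smul, Real.norm_of_nonneg (Real.smoothTransition.nonneg _)]
    gcongr
    exact Real.smoothTransition.le_one _
  have hcQ : Continuous fun x : E => Q fun _ => x := Q.contDiff_diag.continuous
  have hQ0 : (Q fun _ => (0 : E)) = 0 := Q.map_coord_zero 0 rfl
  refine ⟨fun x => u x • g x, fun x => g x - u x • g x, hg₁s, hgs.sub hg₁s, hg₁,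
    fun N => (hg N).sub (hg₁ N), fun x => (add_sub_cancel _ _).symm, fun i x hx => ?_,
    fun i x hx => ?_⟩
  · refine closure_minimal (t := {x | (Q fun _ => x) - η * ‖x‖ ^ 2 ≤ 0}) (fun y hy => ?_)
      (isClosed_le (by fun_prop) continuous_const) (support_iteratedFDeriv_subset i hx)
    rw [Set.mem_ofPred_eq]
    by_contra! h
    rcases eq_or_ne y 0 with rfl | hy0
    · simp [hQ0] at h
    · have hypos := norm_pos_iff.2 hy0
      refine hy ?_
      have : u y = 0 := by
        refine Real.smoothTransition.zero_of_nonpos ?_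
        rw [sub_nonpos, div_le_div_iff₀ two_pos (by positivity)]
        linarith
      simp [this]
  · refine closure_minimal (t := {x | (-Q fun _ => x) - η * ‖x‖ ^ 2 ≤ 0}) (fun y hy => ?_)
      (isClosed_le (by fun_prop) continuous_const) (support_iteratedFDeriv_subset i hx)
    rw [Set.mem_ofPred_eq]
    by_contra! h
    rcases eq_or_ne y 0 with rfl | hy0
    · simp [hQ0] at h
    · have hypos := norm_pos_iff.2 hy0
      refine hy ?_
      have : u y = 1 := by
        refine Real.smoothTransition.one_of_one_le ?_
        rw [le_sub_comm, div_le_iff₀ (by positivity)]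
        linarith
      simp [this]

end Splitting

section Linearisation

open Filter Asymptotics Topology

/-- Smooth linearisation near a fixed point, assuming solvability of the homological equations and
existence of a quadratic Lyapunov function for the linear part. -/
theorem exists_smooth_linearisation {E : Type*} [NormedAddCommGroup E] [InnerProductSpace ℝ E]
    [FiniteDimensional ℝ E] {f g : E → E} {U V : Set E} (hf : ContDiffOn ℝ ∞ f U) (hU : IsOpen U)
    (h0U : 0 ∈ U) (hf0 : f 0 = 0) (hg : ContDiffOn ℝ ∞ g V) (hV : IsOpen V) (h0V : 0 ∈ V)
    (hg0 : g 0 = 0) (hgf : ∀ᶠ x in 𝓝 0, g (f x) = x) (A : E ≃L[ℝ] E)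
    (hfA : HasFDerivAt f (A : E →L[ℝ] E) 0) (hgA : HasFDerivAt g (A.symm : E →L[ℝ] E) 0)
    (hsolve : ∀ (k : ℕ) (Q : ContinuousMultilinearMap ℝ (fun _ : Fin (k + 2) => E) E),
      ∃ M : ContinuousMultilinearMap ℝ (fun _ : Fin (k + 2) => E) E,
        ∀ v, M (fun i => A (v i)) - A (M v) = Q v)
    (Q : ContinuousMultilinearMap ℝ (fun _ : Fin 2 => E) ℝ)
    (hQ : ∀ x, (Q fun _ => A x) - (Q fun _ => x) = ‖x‖ ^ 2) :
    ∃ ψ : E → E, ContDiff ℝ ∞ ψ ∧ ψ 0 = 0 ∧ HasFDerivAt ψ (ContinuousLinearMap.id ℝ E) 0 ∧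
      ∀ᶠ x in 𝓝 0, ψ (f x) = A (ψ x) := by
  have : CompleteSpace E := FiniteDimensional.complete ℝ E
  have hQsymm : ∀ x, ((-Q) fun _ => x) + ((‖(A : E →L[ℝ] E)‖ + 1) ^ 2)⁻¹ * ‖x‖ ^ 2 ≤
      (-Q) fun _ => A.symm x := by
    intro x
    have h1 := hQ (A.symm x)
    rw [A.apply_symm_apply] at h1
    have h2 : ‖x‖ ≤ (‖(A : E →L[ℝ] E)‖ + 1) * ‖A.symm x‖ := by
      calc ‖x‖ = ‖(A : E →L[ℝ] E) (A.symm x)‖ := by simp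
        _ ≤ ‖(A : E →L[ℝ] E)‖ * ‖A.symm x‖ := ContinuousLinearMap.le_opNorm _ _
        _ ≤ _ := by gcongr; linarith
    have h3 : ((‖(A : E →L[ℝ] E)‖ + 1) ^ 2)⁻¹ * ‖x‖ ^ 2 ≤ ‖A.symm x‖ ^ 2 := by
      rw [inv_mul_le_iff₀ (by positivity), ← mul_pow]
      gcongr
    rw [neg_apply, neg_apply]
    linarith
  obtain ⟨ε₁, hε₁, hlyap₁⟩ := exists_lyapunov_of_quadratic (A : E →L[ℝ] E) Q one_pos
    fun x => by rw [one_mul, ← hQ x]; exact (add_sub_cancel _ _).le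
  obtain ⟨ε₂, hε₂, hlyap₂⟩ := exists_lyapunov_of_quadratic (A.symm : E →L[ℝ] E) (-Q)
    (by positivity) hQsymm
  set ε := min ε₁ ε₂ with hε
  have hεpos : 0 < ε := lt_min hε₁ hε₂
  obtain ⟨Φ, hΦ, hΦf, hΦA, hΦb⟩ := hf.exists_global_extension hU h0U hf0 hfA hεpos
  obtain ⟨Ψ, hΨ, hΨg, hΨA, hΨb⟩ := hg.exists_global_extension hV h0V hg0 hgA hεpos
  have hΦ0 : Φ 0 = 0 := by rw [hΦf.self_of_nhds, hf0]
  have hΨ0 : Ψ 0 = 0 := by rw [hΨg.self_of_nhds, hg0]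
  have hΦt : Tendsto Φ (𝓝 0) (𝓝 0) := by simpa [hΦ0] using hΦ.continuous.tendsto 0
  have hΨΦ : ∀ᶠ x in 𝓝 0, Ψ (Φ x) = x := by
    filter_upwards [hgf, hΦf, hΦt.eventually hΨg] with x h1 h2 h3
    rw [h3, h2, h1]
  obtain ⟨ψ₀, hψ₀, hψ₀id, hflat⟩ := exists_flat_linearisation_defect hΦ (A : E →L[ℝ] E)
    (hΦ.sub_fderiv_isBigO hΦ0 (hfA.congr_of_eventuallyEq hΦf)) hsolve
  have hflat' : IsFlatAtZero fun x => A.symm (ψ₀ (Φ x) - A (ψ₀ x)) := fun N =>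
    (A.symm.isBigO_comp _ _).trans (hflat N)
  obtain ⟨g₁, g₂, hg₁, hg₂, hfg₁, hfg₂, hsum, hcone₁, hcone₂⟩ := hflat'.exists_cone_splitting
    (A.symm.contDiff.comp ((hψ₀.comp hΦ).sub (A.contDiff.comp hψ₀))) Q hεpos
  have hbound : ∀ (R : ContinuousMultilinearMap ℝ (fun _ : Fin 2 => E) ℝ) (x : E),
      |(R fun _ => x) - ε * ‖x‖ ^ 2| ≤ (‖R‖ + ε) * ‖x‖ ^ 2 := by
    intro R x
    have h1 := R.norm_diag_le x
    rw [Real.norm_eq_abs] at h1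
    have h2 : |ε * ‖x‖ ^ 2| = ε * ‖x‖ ^ 2 := abs_of_nonneg (by positivity)
    have h3 := abs_sub (R fun _ => x) (ε * ‖x‖ ^ 2)
    linarith
  have hlin : ∀ (B : E →L[ℝ] E) (f : E → E), (∀ x, ‖f x - B x‖ ≤ ε * ‖x‖) →
      ∀ x, ‖f x‖ ≤ (ε + ‖B‖) * ‖x‖ := by
    intro B f h x
    calc ‖f x‖ = ‖(f x - B x) + B x‖ := by rw [sub_add_cancel]
      _ ≤ ε * ‖x‖ + ‖B‖ * ‖x‖ := (norm_add_le _ _).trans (add_le_add (h x) (B.le_opNorm x))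
      _ = _ := by ring
  obtain ⟨c₁, μ₁, hc₁, hμ₁, hμ₁', hcontr₁⟩ := exists_norm_iterate_le_of_lyapunov
    (f := Φ) (q := fun x => (Q fun _ => x) - ε * ‖x‖ ^ 2) (by positivity) (by positivity)
    (hbound Q) (hlin _ Φ hΦA) (hlyap₁ ε hεpos.le (min_le_left _ _) Φ hΦA)
  obtain ⟨c₂, μ₂, hc₂, hμ₂, hμ₂', hcontr₂⟩ := exists_norm_iterate_le_of_lyapunov
    (f := Ψ) (q := fun x => ((-Q) fun _ => x) - ε * ‖x‖ ^ 2) (by positivity) (by positivity)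
    (hbound (-Q)) (hlin _ Ψ hΨA) (hlyap₂ ε hεpos.le (min_le_right _ _) Ψ hΨA)
  obtain ⟨h₁, hh₁, hfh₁, heq₁⟩ := hfg₁.exists_cohomological_solution hΦ hΦ0 hΦb
    (A.symm : E →L[ℝ] E) hg₁ hc₁ hμ₁ hμ₁' fun k i x h => hcontr₁ k x (hcone₁ i _ h)
  obtain ⟨h₂, hh₂, hfh₂, heq₂⟩ := hfg₂.exists_cohomological_solution hΨ hΨ0 hΨb
    (A : E →L[ℝ] E) hg₂ hc₂ hμ₂ hμ₂' fun k i x h => hcontr₂ k x (hcone₂ i _ h)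
  have hO : (fun x => (ψ₀ x + h₁ x + (g₂ x - h₂ x)) - x) =O[𝓝 0] fun x => ‖x‖ ^ 2 := by
    refine ((hψ₀id.add (hfh₁ 2)).add ((hfg₂ 2).sub (hfh₂ 2))).congr_left fun x => ?_
    abel
  have hψ0 : ψ₀ 0 + h₁ 0 + (g₂ 0 - h₂ 0) = 0 := by
    obtain ⟨C, hC⟩ := hO.bound
    simpa using hC.self_of_nhds
  refine ⟨fun x => ψ₀ x + h₁ x + (g₂ x - h₂ x), (hψ₀.add hh₁).add (hg₂.sub hh₂), hψ0, ?_, ?_⟩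
  · have h1 := (IsBigO.hasFDerivAt (x₀ := (0 : E)) (n := 2) (by simpa using hO)
      (by norm_num)).add (hasFDerivAt_id (𝕜 := ℝ) (0 : E))
    rw [zero_add] at h1
    refine h1.congr_of_eventuallyEq (Eventually.of_forall fun x => ?_)
    exact (sub_add_cancel _ _).symm
  · filter_upwards [hΦf, hΨΦ, heq₁, heq₂, hΦt.eventually heq₂] with x e1 e2 e3 e4 e5
    have h5 : ψ₀ (Φ x) - A (ψ₀ x) = A (g₁ x) + A (g₂ x) := by
      rw [← map_add, ← hsum, A.apply_symm_apply]
    have h6 : A (h₁ x) = A (g₁ x) + h₁ (Φ x) := by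
      rw [e3, map_add]
      congr 1
      exact A.apply_symm_apply _
    have h7 : h₂ (Φ x) = g₂ (Φ x) + A (h₂ x) := by
      rw [e5, e2]
      rfl
    rw [← e1, map_add, map_add, map_sub, h6, h7, eq_add_of_sub_eq h5]
    abel

end Linearisation

section Spectrum

/-- The eigenvalues of the complexification of a real endomorphism are among the complex roots of
its characteristic polynomial. -/
theorem exists_eq_of_hasEigenvalue_baseChange {E : Type*} [AddCommGroup E] [Module ℝ E]
    [FiniteDimensional ℝ E] {n : ℕ} (A : E →ₗ[ℝ] E) (s : Fin n → ℂ)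
    (hs : A.charpoly.map (algebraMap ℝ ℂ) = ∏ i, (Polynomial.X - Polynomial.C (s i))) {μ : ℂ}
    (hμ : Module.End.HasEigenvalue (A.baseChange ℂ) μ) : ∃ i, s i = μ := by
  rw [Module.End.hasEigenvalue_iff_isRoot_charpoly, LinearMap.charpoly_baseChange, hs,
    Polynomial.IsRoot.def, Polynomial.eval_prod, Finset.prod_eq_zero_iff] at hμ
  obtain ⟨i, -, hi⟩ := hμ
  refine ⟨i, ?_⟩
  simpa [sub_eq_zero, eq_comm] using hi

/-- Nonresonance in terms of products over tuples of eigenvalues. -/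
theorem ne_prod_comp_of_nonresonant {n : ℕ} {s : Fin n → ℂ}
    (hres : ∀ i, ∀ m : Fin n → ℕ, 1 < ∑ j, m j → s i ≠ ∏ j, s j ^ m j) {k : ℕ} (hk : 1 < k)
    (σ : Fin k → Fin n) (i : Fin n) : s i ≠ ∏ l, s (σ l) := by
  have h1 := hres i (fun j => (Finset.univ.filter fun l => σ l = j).card) (by
    rw [← Finset.card_eq_sum_card_fiberwise fun l _ => Finset.mem_coe.2 (Finset.mem_univ (σ l))]
    simpa using hk)
  rwa [Finset.prod_congr rfl fun j _ => (Finset.prod_eq_pow_card (f := fun l => s (σ l)) fun l hl =>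
    congrArg s (Finset.mem_filter.1 hl).2).symm, Finset.prod_fiberwise] at h1

end Spectrum

/-- **Inverse function theorem** on a full neighbourhood. -/
theorem exists_isSmoothDiffeoOn {n : ℕ}
    {ψ : EuclideanSpace ℝ (Fin n) → EuclideanSpace ℝ (Fin n)} (hψ : ContDiff ℝ ∞ ψ)
    (h : HasFDerivAt ψ (ContinuousLinearMap.id ℝ (EuclideanSpace ℝ (Fin n))) 0) :
    ∃ V : Set (EuclideanSpace ℝ (Fin n)), 0 ∈ V ∧ IsSmoothDiffeoOn n ψ V := by
  have h' : HasFDerivAt ψ (ContinuousLinearEquiv.refl ℝ (EuclideanSpace ℝ (Fin n)) :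
      EuclideanSpace ℝ (Fin n) →L[ℝ] EuclideanSpace ℝ (Fin n)) 0 := h
  set e := hψ.contDiffAt.toOpenPartialHomeomorph ψ h' (by simp)
  have h0 : (0 : EuclideanSpace ℝ (Fin n)) ∈ e.source := hψ.contDiffAt.mem_toOpenPartialHomeomorph_source h' (by simp)
  set V := e.source ∩ fderiv ℝ ψ ⁻¹' Set.range ((↑) :
      (EuclideanSpace ℝ (Fin n) ≃L[ℝ] EuclideanSpace ℝ (Fin n)) →
        EuclideanSpace ℝ (Fin n) →L[ℝ] EuclideanSpace ℝ (Fin n))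
  have hVo : IsOpen V := e.open_source.inter (ContinuousLinearEquiv.isOpen.preimage
    (hψ.continuous_fderiv (by simp)))
  refine ⟨V, ⟨h0, ContinuousLinearEquiv.refl ℝ _, h.fderiv.symm⟩, hVo, hψ.contDiffOn,
    e.injOn.mono Set.inter_subset_left, ?_, e.symm, ?_, fun x hx => e.left_inv hx.1⟩
  · exact e.isOpen_image_of_subset_source hVo Set.inter_subset_left
  · rintro _ ⟨x, ⟨hx, B, hB⟩, rfl⟩
    refine ContDiffAt.contDiffWithinAt (e.contDiffAt_symm (f₀' := B) (e.map_source hx) ?_ ?_)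
    · rw [show e.symm (ψ x) = x from e.left_inv hx, hB]
      exact (hψ.differentiable (by simp) x).hasFDerivAt
    · exact hψ.contDiffAt

/-- **Sternberg's Linearisation Theorem.** If `φ` is a `C^∞` diffeomorphism from a
neighbourhood `U` of `0 ∈ ℝⁿ` onto an open set with `φ 0 = 0`, whose eigenvalues `s i` of the
Jacobian `D₀φ` (counted with multiplicity, i.e. the complex roots of the characteristic
polynomial of the matrix of `D₀φ`) satisfy `s i ≠ s₁ ^ m₁ * ⋯ * sₙ ^ mₙ` for all multi-indices
with `m₁ + ⋯ + mₙ > 1`, then `φ` is `C^∞`-conjugate to its linear part `D₀φ` near the origin. -/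
theorem sternberg_linearisation (n : ℕ) (U : Set (EuclideanSpace ℝ (Fin n)))
    (φ : EuclideanSpace ℝ (Fin n) → EuclideanSpace ℝ (Fin n))
    (h0U : (0 : EuclideanSpace ℝ (Fin n)) ∈ U)
    (hφ : IsSmoothDiffeoOn n φ U) (hφ0 : φ 0 = 0)
    (s : Fin n → ℂ)
    (hs : (Matrix.charpoly
        (LinearMap.toMatrix (EuclideanSpace.basisFun (Fin n) ℝ).toBasis
          (EuclideanSpace.basisFun (Fin n) ℝ).toBasis
          (fderiv ℝ φ 0 : EuclideanSpace ℝ (Fin n) →ₗ[ℝ] EuclideanSpace ℝ (Fin n)))).map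
            (algebraMap ℝ ℂ)
      = ∏ i, (Polynomial.X - Polynomial.C (s i)))
    (hres : ∀ i, ∀ m : Fin n → ℕ, 1 < ∑ j, m j → s i ≠ ∏ j, s j ^ m j) :
    ∃ (V W : Set (EuclideanSpace ℝ (Fin n)))
      (ψ : EuclideanSpace ℝ (Fin n) → EuclideanSpace ℝ (Fin n)),
      (0 : EuclideanSpace ℝ (Fin n)) ∈ V ∧ IsSmoothDiffeoOn n ψ V ∧ ψ 0 = 0 ∧
      IsOpen W ∧ (0 : EuclideanSpace ℝ (Fin n)) ∈ W ∧ W ⊆ U ∩ V ∧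
      ∀ x ∈ W, ψ (φ x) = fderiv ℝ φ 0 (ψ x) := by
  obtain ⟨hU, hφs, -, hφU, χ, hχs, hχφ⟩ := hφ
  have h0V : (0 : EuclideanSpace ℝ (Fin n)) ∈ φ '' U := ⟨0, h0U, hφ0⟩
  have hχ0 : χ 0 = 0 := by simpa [hφ0] using hχφ 0 h0U
  have hχφ' : ∀ᶠ x in nhds 0, χ (φ x) = x := by
    filter_upwards [hU.mem_nhds h0U] with x hx using hχφ x hx
  set A := fderiv ℝ φ 0 with hA
  have hφA : HasFDerivAt φ A 0 :=
    ((hφs.contDiffAt (hU.mem_nhds h0U)).differentiableAt (by simp)).hasFDerivAt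
  have hχB : HasFDerivAt χ (fderiv ℝ χ 0) 0 :=
    ((hχs.contDiffAt (hφU.mem_nhds h0V)).differentiableAt (by simp)).hasFDerivAt
  have hBA : (fderiv ℝ χ 0).comp A = ContinuousLinearMap.id ℝ _ := by
    have h1 : HasFDerivAt (χ ∘ φ) ((fderiv ℝ χ 0).comp A) 0 :=
      HasFDerivAt.comp 0 (by rwa [hφ0]) hφA
    exact h1.unique ((hasFDerivAt_id 0).congr_of_eventuallyEq hχφ')
  have hBA' : (fderiv ℝ χ 0 : EuclideanSpace ℝ (Fin n) →ₗ[ℝ] EuclideanSpace ℝ (Fin n)) ∘ₗ A =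
      LinearMap.id := LinearMap.ext fun x => DFunLike.congr_fun hBA x
  have hAB' := (LinearMap.comp_eq_id_comm ℝ _).1 hBA'
  let A' : EuclideanSpace ℝ (Fin n) ≃L[ℝ] EuclideanSpace ℝ (Fin n) :=
    ContinuousLinearEquiv.equivOfInverse A (fderiv ℝ χ 0) (fun x => DFunLike.congr_fun hBA x)
      fun x => DFunLike.congr_fun hAB' x
  rw [LinearMap.charpoly_toMatrix] at hs
  have hEig := fun μ => exists_eq_of_hasEigenvalue_baseChange _ s hs (μ := μ)
  have hsolve : ∀ (k : ℕ) (Q : ContinuousMultilinearMap ℝ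
      (fun _ : Fin (k + 2) => EuclideanSpace ℝ (Fin n)) (EuclideanSpace ℝ (Fin n))),
      ∃ M : ContinuousMultilinearMap ℝ
        (fun _ : Fin (k + 2) => EuclideanSpace ℝ (Fin n)) (EuclideanSpace ℝ (Fin n)),
        ∀ v, M (fun i => A (v i)) - A (M v) = Q v := by
    intro k Q
    refine exists_sylvester_solution A A (k + 2) (fun μ hμ hμ' => ?_) Q
    choose σ hσ using fun l => hEig _ (hμ l)
    obtain ⟨i, hi⟩ := hEig _ hμ'
    refine ne_prod_comp_of_nonresonant hres (by omega : 1 < k + 2) σ i ?_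
    rw [hi]
    exact Finset.prod_congr rfl fun l _ => (hσ l).symm
  obtain ⟨Q, hQ⟩ := exists_sylvester_solution A (ContinuousLinearMap.id ℝ ℝ) 2
    (fun μ hμ hμ' => by
      choose σ hσ using fun l => hEig _ (hμ l)
      have h1 : ∏ i, μ i = 1 := by
        obtain ⟨z, hz⟩ := hμ'.exists_hasEigenvector
        have h2 := hz.apply_eq_smul
        rw [ContinuousLinearMap.coe_id, LinearMap.baseChange_id, LinearMap.id_apply] at h2
        have h3 : (1 - ∏ i, μ i) • z = 0 := by rw [sub_smul, one_smul, ← h2, sub_self]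
        rcases smul_eq_zero.1 h3 with h3 | h3
        · exact (sub_eq_zero.1 h3).symm
        · exact absurd h3 hz.2
      refine ne_prod_comp_of_nonresonant hres (by norm_num : 1 < 3) ![σ 0, σ 0, σ 1] (σ 0) ?_
      rw [Fin.prod_univ_two, ← hσ, ← hσ] at h1
      rw [Fin.prod_univ_three]
      change s (σ 0) = s (σ 0) * s (σ 0) * s (σ 1)
      rw [mul_assoc, h1, mul_one])
    (∑ i, (ContinuousMultilinearMap.mkPiAlgebra ℝ (Fin 2) ℝ).compContinuousLinearMap
      fun _ => EuclideanSpace.proj i)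
  obtain ⟨ψ, hψ, hψ0, hψid, hψφ⟩ := exists_smooth_linearisation hφs hU h0U hφ0 hχs hφU h0V hχ0
    hχφ' A' hφA hχB hsolve Q fun x => by
      rw [EuclideanSpace.real_norm_sq_eq]
      refine (hQ fun _ => x).trans ?_
      simp [sq]
  obtain ⟨V, hV0, hV⟩ := exists_isSmoothDiffeoOn hψ hψid
  obtain ⟨W, hWsub, hWo, hW0⟩ := eventually_nhds_iff.1 hψφ
  exact ⟨V, W ∩ (U ∩ V), ψ, hV0, hV, hψ0, hWo.inter (hU.inter hV.1), ⟨hW0, h0U, hV0⟩,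
    Set.inter_subset_right, fun x hx => hWsub x hx.1⟩
end

section
/- Let π : G → Q be a surjective group homomorphism with kernel N, let A be an abelian group in which 2 is invertible (i.e., the doubling map a ↦ a + a is bijective, for instance A a real vector space), and let φ : N → A be a G-invariant homomorphism. Then there exists a function F : G → A such that F(n) = φ(n) for all n ∈ N, F(n·g) = φ(n) + F(g) for all n ∈ N and g ∈ G, and additionally F(g⁻¹) = −F(g) for all g ∈ G. -/
/-- Let `π : G → Q` be a surjective group homomorphism with kernel `N`, let `A` be an abelian
group in which `2` is invertible (the doubling map is bijective), and let `φ` be a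
`G`-invariant homomorphism from `N` to `A`.  Then `φ` admits an extension `F : G → A` with
`F (n * g) = φ n + F g` for all `n ∈ N`, `g ∈ G`, and in addition `F g⁻¹ = -F g`. -/
theorem invariant_hom_extends_odd {G Q A : Type*} [Group G] [Group Q] [AddCommGroup A]
    (π : G →* Q) (hπ : Function.Surjective π)
    (h2 : Function.Bijective fun a : A => a + a)
    (φ : G → A)
    (hφmul : ∀ n m : G, n ∈ π.ker → m ∈ π.ker → φ (n * m) = φ n + φ m)
    (hφinv : ∀ g n : G, n ∈ π.ker → φ (g * n * g⁻¹) = φ n) :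
    ∃ F : G → A, (∀ n ∈ π.ker, F n = φ n) ∧
      (∀ n g : G, n ∈ π.ker → F (n * g) = φ n + F g) ∧
      ∀ g : G, F g⁻¹ = -F g := by
  have hφone : φ 1 = 0 := by simpa using hφmul 1 1 (one_mem _) (one_mem _)
  have hφneg : ∀ n ∈ π.ker, φ n⁻¹ = -φ n := fun n hn => by
    have h := hφmul n⁻¹ n (inv_mem hn) hn
    rw [inv_mul_cancel, hφone] at h
    exact eq_neg_of_add_eq_zero_left h.symm
  -- An extension `E` obtained from a set-theoretic section of `π`.
  obtain ⟨E, hE⟩ : ∃ E : G → A, ∀ n g : G, n ∈ π.ker → E (n * g) = φ n + E g := by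
    refine ⟨fun g => φ (g * (Function.surjInv hπ (π g))⁻¹), fun n g hn => ?_⟩
    have hng : π (n * g) = π g := by rw [map_mul, MonoidHom.mem_ker.mp hn, one_mul]
    have hg : g * (Function.surjInv hπ (π g))⁻¹ ∈ π.ker := by
      rw [MonoidHom.mem_ker, map_mul, map_inv, Function.surjInv_eq hπ, mul_inv_cancel]
    simp only [hng, mul_assoc n]
    exact hφmul _ _ hn hg
  -- `F` is the odd part of `E`.
  choose F hF using fun g => h2.surjective (E g - E g⁻¹)
  simp only at hF
  have hFodd : ∀ g, F g⁻¹ = -F g := fun g => by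
    apply h2.injective
    simp only
    rw [hF, inv_inv, ← neg_add, hF, neg_sub]
  have hFmul : ∀ n g : G, n ∈ π.ker → F (n * g) = φ n + F g := fun n g hn => by
    have hinv : E (n * g)⁻¹ = -φ n + E g⁻¹ := by
      have hconj : g⁻¹ * n⁻¹ * g⁻¹⁻¹ ∈ π.ker :=
        (inferInstance : π.ker.Normal).conj_mem _ (inv_mem hn) _
      rw [← hφneg n hn, ← hφinv g⁻¹ n⁻¹ (inv_mem hn), ← hE _ _ hconj]
      congr 1
      group
    apply h2.injective
    simp only
    rw [hF, hE n g hn, hinv, add_add_add_comm, hF]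
    abel
  have hFone : F 1 = 0 := by
    apply h2.injective
    simp only
    rw [hF, inv_one, sub_self, add_zero]
  exact ⟨F, fun n hn => by simpa [hFone] using hFmul n 1 hn, hFmul, hFodd⟩
end
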